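/- Suppose η < 1. Then there exists a unique absolutely continuous stationary probability measure μ_p for F, i.e. a unique Borel probability measure μ_p on [0,1] absolutely continuous with respect to Lebesgue measure λ satisfying Σ_{j∈Σ} p_j μ_p(T_j⁻¹A) = μ_p(A) for all Borel sets A ⊆ [0,1]; moreover the skew product F is ergodic with respect to the (F-invariant) product measure ℙ × μ_p. -/

import Mathlib

open MeasureTheory Set

/-- Left branch of the LSV-type maps: `x ↦ x(1 + 2^α x^α)`. -/
noncomputable def lsvLeft (α x : ℝ) : ℝ := x * (1 + 2 ^ α * x ^ α)

/-- The LSV map `S_α`. -/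
noncomputable def lsvMap (α : ℝ) (x : ℝ) : ℝ :=
  if x ≤ 1 / 2 then lsvLeft α x else 2 * x - 1

/-- The map `R_{α,K}`. -/
noncomputable def rMap (α K : ℝ) (x : ℝ) : ℝ :=
  if x ≤ 1 / 2 then lsvLeft α x
  else 1 / 2 + K * (x - 1 / 2) + 2 * (1 - K) * (x - 1 / 2) ^ 2

/-- The skew product `F(ω,x) = (σω, T_{ω₁}(x))`. -/
def skewProd {N : ℕ} (T : Fin N → ℝ → ℝ) :
    ((ℕ → Fin N) × ℝ) → ((ℕ → Fin N) × ℝ) :=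
  fun q => (fun k => q.1 (k + 1), T (q.1 0) q.2)

section

open Filter Topology

/-- Comparison of finite Borel measures on the line through half-open intervals. -/
theorem measure_le_of_Ioc {μ ν : Measure ℝ} [IsFiniteMeasure μ] [IsFiniteMeasure ν]
    (h : ∀ a b : ℝ, a < b → μ (Ioc a b) ≤ ν (Ioc a b)) : μ ≤ ν := by
  have rc : ∀ (m : Measure ℝ) [IsFiniteMeasure m] (x : ℝ),
      ContinuousWithinAt (fun t => m.real (Iic t)) (Ici x) x := by
    intro m _ x
    rw [← continuousWithinAt_Ioi_iff_Ici]
    have h1 := tendsto_measure_biInter_gt (μ := m) (s := fun t : ℝ => Iic t) (a := x)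
      (fun r _ => measurableSet_Iic.nullMeasurableSet) (fun i j _ hij => Iic_subset_Iic.2 hij)
      ⟨x + 1, by simp, measure_ne_top _ _⟩
    have h2 : (⋂ r, ⋂ (_ : r > x), Iic r) = Iic x := by
      ext y
      simp only [mem_iInter, mem_Iic]
      exact ⟨fun hy => le_of_forall_gt_imp_ge_of_dense hy, fun hy r hr => hy.trans hr.le⟩
    rw [h2] at h1
    exact (ENNReal.tendsto_toReal (measure_ne_top m _)).comp h1
  have hIoc : ∀ (m : Measure ℝ) [IsFiniteMeasure m] (a b : ℝ), a ≤ b →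
      m.real (Ioc a b) = m.real (Iic b) - m.real (Iic a) := by
    intro m _ a b hab
    have hd : Ioc a b = Iic b \ Iic a := by
      ext y; simp [and_comm]
    rw [hd, measureReal_sdiff (Iic_subset_Iic.2 hab) measurableSet_Iic]
  let g : StieltjesFunction ℝ :=
    { toFun := fun t => ν.real (Iic t) - μ.real (Iic t)
      mono' := by
        intro a b hab
        rcases hab.eq_or_lt with rfl | hlt
        · exact le_rfl
        · have h1 : μ.real (Ioc a b) ≤ ν.real (Ioc a b) :=
            ENNReal.toReal_mono (measure_ne_top _ _) (h a b hlt)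
          rw [hIoc μ a b hab, hIoc ν a b hab] at h1
          simp only
          linarith
      right_continuous' := fun x => (rc ν x).sub (rc μ x) }
  have : μ + g.measure = ν := by
    symm
    apply Measure.ext_of_Ioc
    intro a b hab
    have h1 : μ.real (Ioc a b) ≤ ν.real (Ioc a b) :=
      ENNReal.toReal_mono (measure_ne_top _ _) (h a b hab)
    rw [Measure.add_apply, StieltjesFunction.measure_Ioc]
    have h2 : g b - g a = ν.real (Ioc a b) - μ.real (Ioc a b) := by
      rw [hIoc μ a b hab.le, hIoc ν a b hab.le]
      change (ν.real (Iic b) - μ.real (Iic b)) - (ν.real (Iic a) - μ.real (Iic a)) = _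
      ring
    rw [h2, ← ofReal_measureReal (μ := μ), ← ofReal_measureReal (μ := ν),
      ← ENNReal.ofReal_add measureReal_nonneg (by linarith)]
    congr 1; ring
  rw [← this]
  exact Measure.le_add_right le_rfl

/-- The inverse of a convex increasing bijection between intervals is monotone and concave. -/
theorem exists_concave_inverse {f : ℝ → ℝ} {a b c d : ℝ} (hab : a < b)
    (hf : ConvexOn ℝ (Icc a b) f) (hc : ContinuousOn f (Icc a b))
    (hm : StrictMonoOn f (Icc a b)) (ha : f a = c) (hb : f b = d) :
    ∃ g : ℝ → ℝ, (∀ t ∈ Icc c d, g t ∈ Icc a b ∧ f (g t) = t) ∧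
      (∀ t ∈ Icc c d, ∀ x ∈ Icc a b, f x ≤ t ↔ x ≤ g t) ∧
      MonotoneOn g (Icc c d) ∧ ConcaveOn ℝ (Icc c d) g := by
  have hsurj : ∀ t ∈ Icc c d, ∃ x ∈ Icc a b, f x = t := by
    intro t ht
    have := intermediate_value_Icc hab.le hc
    rw [ha, hb] at this
    exact this ht
  choose! g hg using hsurj
  have key : ∀ t ∈ Icc c d, ∀ x ∈ Icc a b, f x ≤ t ↔ x ≤ g t := by
    intro t ht x hx
    conv_lhs => rw [← (hg t ht).2]
    exact hm.le_iff_le hx (hg t ht).1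
  refine ⟨g, hg, key, ?_, convex_Icc _ _, ?_⟩
  · intro s hs t ht hst
    rw [← key t ht _ (hg s hs).1, (hg s hs).2]
    exact hst
  · intro s hs t ht u v hu hv huv
    have hmem : u • g s + v • g t ∈ Icc a b := (convex_Icc a b) (hg s hs).1 (hg t ht).1 hu hv huv
    rw [← key _ ((convex_Icc c d) hs ht hu hv huv) _ hmem]
    have := hf.2 (hg s hs).1 (hg t ht).1 hu hv huv
    rwa [(hg s hs).2, (hg t ht).2] at this

/-- On a concave function the increments to the right are controlled by increments to the left. -/
theorem ConcaveOn.increment_le {G : ℝ → ℝ} {S : Set ℝ} (hG : ConcaveOn ℝ S G)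
    {o a b : ℝ} (ho : o ∈ S) (hb : b ∈ S) (hoa : o < a) (hab : a ≤ b) :
    G b - G a ≤ (b - a) / (a - o) * (G a - G o) := by
  rcases hab.eq_or_lt with rfl | hlt
  · simp
  · have h := hG.slope_anti_adjacent ho hb hoa hlt
    rw [div_le_div_iff₀ (by linarith) (by linarith)] at h
    rw [div_mul_eq_mul_div, le_div_iff₀ (by linarith)]
    linarith

/-- Lower bound for the increments of a concave function by the slope further right. -/
theorem ConcaveOn.le_increment {G : ℝ → ℝ} {S : Set ℝ} (hG : ConcaveOn ℝ S G)
    {s t a b c : ℝ} (hs : s ∈ S) (ht : t ∈ S) (ha : a ∈ S) (hb : b ∈ S)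
    (hst : s ≤ t) (hta : t ≤ a) (hab : a < b) (hc : c ≤ (G b - G a) / (b - a)) :
    c * (t - s) ≤ G t - G s := by
  rcases hst.eq_or_lt with rfl | hlt
  · simp
  · have h1 : (G b - G a) / (b - a) ≤ (G t - G s) / (t - s) := by
      rcases hta.eq_or_lt with rfl | hlt'
      · exact hG.slope_anti_adjacent hs hb hlt hab
      · exact (hG.slope_anti_adjacent ht hb hlt' hab).trans (hG.slope_anti_adjacent hs ha hlt hlt')
    have := hc.trans h1
    rwa [le_div_iff₀ (by linarith)] at this

/-- A finite family of two-branch interval maps `T j` chosen with probabilities `p j`, together with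
the inverse `y j` of the left branch and the (truncated) inverse `z j` of the right branch, and the
quantitative information used to control stationary measures. -/
structure RandomSystem (N : ℕ) where
  (T y z : Fin N → ℝ → ℝ)
  (p e K : Fin N → ℝ)
  SR : Finset (Fin N)
  (a γ : ℝ)
  (jmin s : Fin N)
  meas : ∀ j, Measurable (T j)
  p_pos : ∀ j, 0 < p j
  p_sum : ∑ j, p j = 1
  maps_to : ∀ j, ∀ x ∈ Ioc (0 : ℝ) 1, T j x ∈ Ioc (0 : ℝ) 1
  preim : ∀ j, ∀ t ∈ Icc (0 : ℝ) 1, ∀ x ∈ Ioc (0 : ℝ) 1,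
    T j x ≤ t ↔ x ≤ y j t ∨ (1 / 2 < x ∧ x ≤ z j t)
  y_mem : ∀ j, ∀ t ∈ Icc (0 : ℝ) 1, y j t ∈ Icc (0 : ℝ) (1 / 2)
  z_mem : ∀ j, ∀ t ∈ Icc (0 : ℝ) 1, z j t ∈ Icc (1 / 2 : ℝ) 1
  y_mono : ∀ j, MonotoneOn (y j) (Icc 0 1)
  z_mono : ∀ j, MonotoneOn (z j) (Icc 0 1)
  y_concave : ∀ j, ConcaveOn ℝ (Icc 0 1) (y j)
  z_concave_left : ∀ j, ConcaveOn ℝ (Icc 0 (1 / 2)) (z j)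
  z_concave_right : ∀ j, ConcaveOn ℝ (Icc (1 / 2) 1) (z j)
  y_zero : ∀ j, y j 0 = 0
  y_one : ∀ j, y j 1 = 1 / 2
  y_half : ∀ j, 1 / 4 ≤ y j (1 / 2)
  y_expand : ∀ j, ∀ u ∈ Icc (0 : ℝ) 1, ∀ t ∈ Icc (0 : ℝ) 1, u ≤ t →
    (y j t - y j u) * (1 + y j t ^ e j) ≤ t - u
  T_y : ∀ j, ∀ t ∈ Ioc (0 : ℝ) 1, T j (y j t) = t
  T_z : ∀ j ∉ SR, ∀ t ∈ Ioc (0 : ℝ) 1, T j ((1 + t) / 2) = t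
  z_S : ∀ j ∉ SR, ∀ t ∈ Icc (0 : ℝ) 1, z j t = (1 + t) / 2
  z_R_left : ∀ j ∈ SR, ∀ t ∈ Icc (0 : ℝ) (1 / 2), z j t = 1 / 2
  z_R_right : ∀ j ∈ SR, ∀ t ∈ Icc (0 : ℝ) (1 / 2), z j (1 / 2 + t) - 1 / 2 ≤ t / K j
  e_pos : ∀ j, 0 < e j
  K_pos : ∀ j ∈ SR, 0 < K j
  s_notMem : s ∉ SR
  a_pos : 0 < a
  a_lt : a < γ
  γ_lt : γ < 1
  eta_lt : ∑ r ∈ SR, p r * K r ^ (-γ) < 1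
  y_min : ∀ t ∈ Icc (0 : ℝ) 1, y jmin t ≤ t * (1 - t ^ a / 2)

namespace RandomSystem

variable {N : ℕ} (S : RandomSystem N)

/-- The dual transfer operator: the law of `T j x` when `x` has law `ν` and `j` has law `p`. -/
noncomputable def push (ν : Measure ℝ) : Measure ℝ :=
  ∑ j, ENNReal.ofReal (S.p j) • ν.map (S.T j)

theorem y_le (j : Fin N) {t : ℝ} (ht : t ∈ Icc (0 : ℝ) 1) : S.y j t ≤ t := by
  have h := S.y_expand j 0 (by simp) t ht ht.1
  have h0 := (S.y_mem j t ht).1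
  have := Real.rpow_nonneg h0 (S.e j)
  rw [S.y_zero] at h
  nlinarith

theorem y_sub_le (j : Fin N) {u t : ℝ} (hu : u ∈ Icc (0 : ℝ) 1) (ht : t ∈ Icc (0 : ℝ) 1)
    (hut : u ≤ t) : S.y j t - S.y j u ≤ t - u := by
  have h := S.y_expand j u hu t ht hut
  have := Real.rpow_nonneg (S.y_mem j t ht).1 (S.e j)
  have := S.y_mono j hu ht hut
  nlinarith

theorem p_sum_ofReal : ∑ j, ENNReal.ofReal (S.p j) = 1 := by
  rw [← ENNReal.ofReal_sum_of_nonneg (fun j _ => (S.p_pos j).le), S.p_sum, ENNReal.ofReal_one]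

theorem push_apply (ν : Measure ℝ) {E : Set ℝ} (hE : MeasurableSet E) :
    S.push ν E = ∑ j, ENNReal.ofReal (S.p j) * ν (S.T j ⁻¹' E) := by
  simp only [push, Measure.coe_finsetSum, Finset.sum_apply, Measure.smul_apply, smul_eq_mul]
  exact Finset.sum_congr rfl fun j _ => by rw [Measure.map_apply (S.meas j) hE]

theorem push_univ (ν : Measure ℝ) : S.push ν univ = ν univ := by
  rw [S.push_apply ν MeasurableSet.univ]
  simp only [preimage_univ]
  rw [← Finset.sum_mul, S.p_sum_ofReal, one_mul]

instance isFiniteMeasure_push (ν : Measure ℝ) [IsFiniteMeasure ν] : IsFiniteMeasure (S.push ν) :=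
  ⟨by rw [S.push_univ]; exact measure_lt_top _ _⟩

instance isProbabilityMeasure_push (ν : Measure ℝ) [IsProbabilityMeasure ν] :
    IsProbabilityMeasure (S.push ν) := ⟨by rw [S.push_univ]; exact measure_univ⟩

theorem push_real (ν : Measure ℝ) [IsFiniteMeasure ν] {E : Set ℝ} (hE : MeasurableSet E) :
    (S.push ν).real E = ∑ j, S.p j * ν.real (S.T j ⁻¹' E) := by
  rw [Measure.real, S.push_apply ν hE, ENNReal.toReal_sum
    (fun j _ => ENNReal.mul_ne_top ENNReal.ofReal_ne_top (measure_ne_top _ _))]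
  exact Finset.sum_congr rfl fun j _ => by
    rw [ENNReal.toReal_mul, ENNReal.toReal_ofReal (S.p_pos j).le]; rfl

theorem push_mono {ν ν' : Measure ℝ} (h : ν ≤ ν') : S.push ν ≤ S.push ν' := by
  refine Measure.le_iff.2 fun E hE => ?_
  rw [S.push_apply _ hE, S.push_apply _ hE]
  gcongr

theorem push_add (ν ν' : Measure ℝ) : S.push (ν + ν') = S.push ν + S.push ν' := by
  ext E hE
  rw [Measure.add_apply, S.push_apply _ hE, S.push_apply _ hE, S.push_apply _ hE,
    ← Finset.sum_add_distrib]
  simp only [Measure.add_apply, mul_add]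

theorem push_supp {ν : Measure ℝ} (h : ν (Ioc 0 1)ᶜ = 0) : S.push ν (Ioc 0 1)ᶜ = 0 := by
  rw [S.push_apply _ measurableSet_Ioc.compl]
  refine Finset.sum_eq_zero fun j _ => ?_
  rw [measure_mono_null _ h, mul_zero]
  intro x hx hx'
  exact hx (S.maps_to j x hx')

theorem push_Iic (ν : Measure ℝ) [IsFiniteMeasure ν] (h : ν (Ioc 0 1)ᶜ = 0) {t : ℝ}
    (ht : t ∈ Icc (0 : ℝ) 1) :
    (S.push ν).real (Iic t) = ∑ j, S.p j * (ν.real (Iic (S.y j t)) +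
      (ν.real (Iic (S.z j t)) - ν.real (Iic (1 / 2)))) := by
  rw [S.push_real ν measurableSet_Iic]
  refine Finset.sum_congr rfl fun j _ => ?_
  congr 1
  have h1 : S.T j ⁻¹' Iic t =ᵐ[ν] (Iic (S.y j t) ∪ (Iic (S.z j t) \ Iic (1 / 2)) : Set ℝ) := by
    have h' : ∀ᵐ x ∂ν, x ∈ Ioc (0 : ℝ) 1 := h
    filter_upwards [h'] with x hx
    apply propext
    change S.T j x ≤ t ↔ x ≤ S.y j t ∨ (x ≤ S.z j t ∧ ¬ x ≤ 1 / 2)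
    rw [S.preim j t ht x hx, not_le, and_comm (a := x ≤ S.z j t)]
  have hd : Disjoint (Iic (S.y j t)) (Iic (S.z j t) \ Iic (1 / 2)) := by
    rw [Set.disjoint_left]
    intro x hx hx'
    exact hx'.2 (le_trans hx (S.y_mem j t ht).2)
  rw [measureReal_congr h1, measureReal_union hd (measurableSet_Iic.diff measurableSet_Iic),
    measureReal_sdiff (Iic_subset_Iic.2 (S.z_mem j t ht).1) measurableSet_Iic]

/-- Probability measures on `(0,1]` whose distribution function is concave on both halves and
satisfies power bounds at `0` and at `1/2`. -/
structure Good (A B : ℝ) (ν : Measure ℝ) : Prop where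
  prob : IsProbabilityMeasure ν
  supp : ν (Ioc 0 1)ᶜ = 0
  concave_left : ConcaveOn ℝ (Icc 0 (1 / 2)) fun t => ν.real (Iic t)
  concave_right : ConcaveOn ℝ (Icc (1 / 2) 1) fun t => ν.real (Iic t)
  bound_right : ∀ t ∈ Icc (0 : ℝ) (1 / 2),
    ν.real (Iic (1 / 2 + t)) - ν.real (Iic (1 / 2)) ≤ A * t ^ S.γ
  bound_left : ∀ t ∈ Icc (0 : ℝ) (1 / 2), ν.real (Iic t) ≤ B * t ^ (S.γ - S.a)

/-- The contraction constant for the bound at `1/2`. -/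
noncomputable def eta : ℝ := ∑ r ∈ S.SR, S.p r * S.K r ^ (-S.γ)

theorem real_Iic_zero {ν : Measure ℝ} (h : ν (Ioc 0 1)ᶜ = 0) : ν.real (Iic 0) = 0 := by
  rw [Measure.real, measure_mono_null _ h, ENNReal.toReal_zero]
  intro x hx hx'
  exact absurd hx'.1 (not_lt.2 hx)

theorem real_Iic_one {ν : Measure ℝ} [IsProbabilityMeasure ν] (h : ν (Ioc 0 1)ᶜ = 0) :
    ν.real (Iic 1) = 1 := by
  have h1 : (Iic (1 : ℝ)) =ᵐ[ν] (univ : Set ℝ) := by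
    have h' : ∀ᵐ x ∂ν, x ∈ Ioc (0 : ℝ) 1 := h
    filter_upwards [h'] with x hx
    exact propext ⟨fun _ => trivial, fun _ => hx.2⟩
  rw [measureReal_congr h1, probReal_univ]

theorem monotone_Iic (ν : Measure ℝ) [IsFiniteMeasure ν] : Monotone fun t => ν.real (Iic t) :=
  fun _ _ h => measureReal_mono (Iic_subset_Iic.2 h)

theorem concaveOn_finset_sum {ι : Type*} (s : Finset ι) {I : Set ℝ} (hI : Convex ℝ I)
    {c : ι → ℝ} (hc : ∀ i ∈ s, 0 ≤ c i) {f : ι → ℝ → ℝ} (hf : ∀ i ∈ s, ConcaveOn ℝ I (f i)) :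
    ConcaveOn ℝ I fun t => ∑ i ∈ s, c i * f i t := by
  induction s using Finset.cons_induction with
  | empty => simpa using concaveOn_const (0 : ℝ) hI
  | cons i s hi ih =>
    simp only [Finset.sum_cons]
    refine ConcaveOn.add ?_ (ih (fun k hk => hc k (by simp [hk])) fun k hk => hf k (by simp [hk]))
    exact (hf i (by simp)).smul (hc i (by simp))

theorem concave_push {ν : Measure ℝ} [IsFiniteMeasure ν] (h : ν (Ioc 0 1)ᶜ = 0)
    (hl : ConcaveOn ℝ (Icc 0 (1 / 2)) fun t => ν.real (Iic t))
    (hr : ConcaveOn ℝ (Icc (1 / 2) 1) fun t => ν.real (Iic t))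
    {I : Set ℝ} (hI : Convex ℝ I) (hI1 : I ⊆ Icc 0 1) (hz : ∀ j, ConcaveOn ℝ I (S.z j)) :
    ConcaveOn ℝ I fun t => (S.push ν).real (Iic t) := by
  have hmain : ConcaveOn ℝ I fun t => ∑ j, S.p j * (ν.real (Iic (S.y j t)) +
      (ν.real (Iic (S.z j t)) - ν.real (Iic (1 / 2)))) := by
    have comp : ∀ {J : Set ℝ} {g : ℝ → ℝ}, ConcaveOn ℝ J (fun t => ν.real (Iic t)) →
        ConcaveOn ℝ I g → MapsTo g I J → ConcaveOn ℝ I fun t => ν.real (Iic (g t)) := by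
      intro J g hJ hg hgJ
      refine ⟨hI, fun x hx x' hx' u v hu hv huv => ?_⟩
      refine (hJ.2 (hgJ hx) (hgJ hx') hu hv huv).trans ?_
      exact monotone_Iic ν (hg.2 hx hx' hu hv huv)
    refine concaveOn_finset_sum _ hI (fun j _ => (S.p_pos j).le) fun j _ => ?_
    refine (comp hl ((S.y_concave j).subset hI1 hI) fun t ht => S.y_mem j t (hI1 ht)).add ?_
    exact (comp hr (hz j) fun t ht => S.z_mem j t (hI1 ht)).sub (convexOn_const _ hI)
  refine hmain.congr ?_
  intro t ht
  exact (S.push_Iic ν h (hI1 ht)).symm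

end RandomSystem

namespace RandomSystem

variable {N : ℕ} (S : RandomSystem N)

theorem eta_nonneg : 0 ≤ S.eta :=
  Finset.sum_nonneg fun r hr => mul_nonneg (S.p_pos r).le (Real.rpow_nonneg (S.K_pos r hr).le _)

variable {S}

theorem γ_pos : 0 < S.γ := S.a_pos.trans S.a_lt

theorem le_rpow_γ {t : ℝ} (ht : t ∈ Icc (0 : ℝ) 1) : t ≤ t ^ S.γ :=
  Real.self_le_rpow_of_le_one ht.1 ht.2 S.γ_lt.le

theorem Good.bound_right_push {A B : ℝ} {ν : Measure ℝ} (h : S.Good A B ν) (hA : 0 ≤ A)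
    {t : ℝ} (ht : t ∈ Icc (0 : ℝ) (1 / 2)) :
    (S.push ν).real (Iic (1 / 2 + t)) - (S.push ν).real (Iic (1 / 2)) ≤
      (6 + S.eta * A) * t ^ S.γ := by
  have := h.prob
  have ht1 : (1 / 2 + t : ℝ) ∈ Icc (0 : ℝ) 1 := ⟨by linarith [ht.1], by linarith [ht.2]⟩
  have hh : (1 / 2 : ℝ) ∈ Icc (0 : ℝ) 1 := by constructor <;> norm_num
  have ht' : t ∈ Icc (0 : ℝ) 1 := ⟨ht.1, by linarith [ht.2]⟩
  have htγ := le_rpow_γ (S := S) ht'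
  have htγ0 : 0 ≤ t ^ S.γ := Real.rpow_nonneg ht.1 _
  rw [S.push_Iic ν h.supp ht1, S.push_Iic ν h.supp hh, ← Finset.sum_sub_distrib]
  have hy : ∀ j, ν.real (Iic (S.y j (1 / 2 + t))) - ν.real (Iic (S.y j (1 / 2))) ≤ 4 * t := by
    intro j
    have hle := S.y_mono j hh ht1 (by linarith [ht.1])
    have h4 := S.y_half j
    have h1 := h.concave_left.increment_le (o := 0) (by constructor <;> norm_num)
      (S.y_mem j _ ht1) (by linarith : (0 : ℝ) < S.y j (1 / 2)) hle
    have h2 := S.y_sub_le j hh ht1 (by linarith [ht.1])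
    simp only [real_Iic_zero h.supp, sub_zero] at h1
    refine h1.trans ?_
    have h3 : ν.real (Iic (S.y j (1 / 2))) ≤ 1 := measureReal_le_one
    have h5 : (S.y j (1 / 2 + t) - S.y j (1 / 2)) / S.y j (1 / 2) ≤ 4 * t := by
      rw [div_le_iff₀ (by linarith)]
      nlinarith [ht.1]
    have h6 : 0 ≤ (S.y j (1 / 2 + t) - S.y j (1 / 2)) / S.y j (1 / 2) :=
      div_nonneg (by linarith) (by linarith)
    nlinarith [measureReal_nonneg (μ := ν) (s := Iic (S.y j (1 / 2)))]
  have hz : ∀ j, ν.real (Iic (S.z j (1 / 2 + t))) - ν.real (Iic (S.z j (1 / 2))) ≤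
      2 * t + if j ∈ S.SR then A * (S.K j ^ (-S.γ) * t ^ S.γ) else 0 := by
    intro j
    split_ifs with hj
    · have hw := S.z_R_right j hj t ht
      have hm := S.z_mem j _ ht1
      have h1 := h.bound_right (S.z j (1 / 2 + t) - 1 / 2)
        ⟨by linarith [hm.1], by linarith [hm.2]⟩
      have hK := S.K_pos j hj
      have h2 : (S.z j (1 / 2 + t) - 1 / 2) ^ S.γ ≤ S.K j ^ (-S.γ) * t ^ S.γ := by
        refine (Real.rpow_le_rpow (by linarith [hm.1]) hw γ_pos.le).trans ?_
        rw [Real.div_rpow ht.1 hK.le, Real.rpow_neg hK.le, div_eq_mul_inv, mul_comm]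
      rw [S.z_R_left j hj (1 / 2) (by constructor <;> norm_num)]
      rw [add_sub_cancel] at h1
      nlinarith [mul_le_mul_of_nonneg_left h2 hA, ht.1]
    · rw [S.z_S j hj _ ht1, S.z_S j hj _ hh]
      have h1 := h.concave_right.increment_le (o := 1 / 2) (a := (1 + 1 / 2) / 2)
        (b := (1 + (1 / 2 + t)) / 2) (by constructor <;> norm_num)
        ⟨by linarith [ht.1], by linarith [ht.2]⟩ (by norm_num) (by linarith [ht.1])
      refine h1.trans ?_
      have h3 : ν.real (Iic ((1 + 1 / 2 : ℝ) / 2)) ≤ 1 := measureReal_le_one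
      have h4 : 0 ≤ ν.real (Iic (1 / 2 : ℝ)) := measureReal_nonneg
      have h5 : ((1 + (1 / 2 + t)) / 2 - (1 + 1 / 2) / 2) / ((1 + 1 / 2) / 2 - 1 / 2) = 2 * t := by
        ring
      rw [h5]
      nlinarith [ht.1]
  calc _ ≤ ∑ j, S.p j * (4 * t + (2 * t +
        if j ∈ S.SR then A * (S.K j ^ (-S.γ) * t ^ S.γ) else 0)) := by
        refine Finset.sum_le_sum fun j _ => ?_
        rw [← mul_sub]
        refine mul_le_mul_of_nonneg_left ?_ (S.p_pos j).le
        linarith [hy j, hz j]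
    _ = (∑ j, S.p j) * (6 * t) + S.eta * A * t ^ S.γ := by
        rw [eta, Finset.sum_mul, Finset.sum_mul, Finset.sum_mul,
          ← Finset.sum_filter_add_sum_filter_not Finset.univ (· ∈ S.SR)
            (fun j => S.p j * (6 * t)),
          ← Finset.sum_filter_add_sum_filter_not Finset.univ (· ∈ S.SR)]
        have hf : Finset.univ.filter (· ∈ S.SR) = S.SR := by ext; simp
        have e2 : ∑ x with x ∉ S.SR, S.p x * (4 * t + (2 * t +
            if x ∈ S.SR then A * (S.K x ^ (-S.γ) * t ^ S.γ) else 0)) =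
            ∑ x with x ∉ S.SR, S.p x * (6 * t) := by
          refine Finset.sum_congr rfl fun j hj => ?_
          rw [if_neg (Finset.mem_filter.1 hj).2]; ring
        have e1 : ∑ x with x ∈ S.SR, S.p x * (4 * t + (2 * t +
            if x ∈ S.SR then A * (S.K x ^ (-S.γ) * t ^ S.γ) else 0)) =
            ∑ x with x ∈ S.SR, S.p x * (6 * t) +
              ∑ x ∈ S.SR, S.p x * S.K x ^ (-S.γ) * A * t ^ S.γ := by
          rw [hf, ← Finset.sum_add_distrib]
          refine Finset.sum_congr rfl fun j hj => ?_
          rw [if_pos hj]; ring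
        rw [e1, e2]; ring
    _ ≤ _ := by rw [S.p_sum]; linarith

/-- The mass that reaches a neighbourhood of `0` from the right half. -/
theorem Good.z_term_le {A B : ℝ} {ν : Measure ℝ} (h : S.Good A B ν) (hA : 0 ≤ A)
    {t : ℝ} (ht : t ∈ Icc (0 : ℝ) (1 / 2)) (j : Fin N) :
    ν.real (Iic (S.z j t)) - ν.real (Iic (1 / 2)) ≤ A * t ^ S.γ := by
  have ht' : t ∈ Icc (0 : ℝ) 1 := ⟨ht.1, by linarith [ht.2]⟩
  by_cases hj : j ∈ S.SR
  · rw [S.z_R_left j hj t ht, sub_self]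
    exact mul_nonneg hA (Real.rpow_nonneg ht.1 _)
  · rw [S.z_S j hj t ht']
    have h1 := h.bound_right (t / 2) ⟨by linarith [ht.1], by linarith [ht.1, ht.2]⟩
    rw [show (1 + t) / 2 = 1 / 2 + t / 2 by ring]
    refine h1.trans (mul_le_mul_of_nonneg_left ?_ hA)
    exact Real.rpow_le_rpow (by linarith [ht.1]) (by linarith [ht.1]) γ_pos.le

/-- The gain in the power bound at `0` from the map with the smallest exponent. -/
theorem rpow_y_min_le {t : ℝ} (ht : t ∈ Icc (0 : ℝ) (1 / 2)) :
    S.y S.jmin t ^ (S.γ - S.a) ≤ t ^ (S.γ - S.a) - (S.γ - S.a) / 2 * t ^ S.γ := by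
  have hδ : 0 < S.γ - S.a := sub_pos.2 S.a_lt
  have ht' : t ∈ Icc (0 : ℝ) 1 := ⟨ht.1, by linarith [ht.2]⟩
  rcases ht.1.eq_or_lt with rfl | h0
  · rw [S.y_zero, Real.zero_rpow hδ.ne', Real.zero_rpow γ_pos.ne']; simp
  · have hta : t ^ S.a ≤ 1 := Real.rpow_le_one ht.1 ht'.2 S.a_pos.le
    have hta0 : 0 ≤ t ^ S.a := Real.rpow_nonneg ht.1 _
    have h1 := Real.rpow_le_rpow (S.y_mem S.jmin t ht').1 (S.y_min t ht') hδ.le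
    rw [Real.mul_rpow ht.1 (by linarith)] at h1
    have h2 := rpow_one_add_le_one_add_mul_self (s := -(t ^ S.a / 2)) (by linarith) hδ.le
      (by linarith [S.a_pos, S.γ_lt])
    have h3 : t ^ S.γ = t ^ (S.γ - S.a) * t ^ S.a := by
      rw [← Real.rpow_add h0]; congr 1; ring
    have h4 : 0 ≤ t ^ (S.γ - S.a) := Real.rpow_nonneg ht.1 _
    rw [h3]
    rw [← sub_eq_add_neg] at h2
    nlinarith [mul_le_mul_of_nonneg_left h2 h4]

theorem Good.bound_left_push {A B : ℝ} {ν : Measure ℝ} (h : S.Good A B ν) (hA : 0 ≤ A)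
    (hB : 2 * A ≤ B * (S.p S.jmin * (S.γ - S.a))) (hB0 : 0 ≤ B)
    {t : ℝ} (ht : t ∈ Icc (0 : ℝ) (1 / 2)) :
    (S.push ν).real (Iic t) ≤ B * t ^ (S.γ - S.a) := by
  have := h.prob
  have hδ : 0 < S.γ - S.a := sub_pos.2 S.a_lt
  have ht' : t ∈ Icc (0 : ℝ) 1 := ⟨ht.1, by linarith [ht.2]⟩
  rw [S.push_Iic ν h.supp ht']
  have htγ0 : 0 ≤ t ^ S.γ := Real.rpow_nonneg ht.1 _
  have hy : ∀ j, ν.real (Iic (S.y j t)) ≤ B * t ^ (S.γ - S.a) -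
      if j = S.jmin then B * ((S.γ - S.a) / 2 * t ^ S.γ) else 0 := by
    intro j
    refine (h.bound_left _ (S.y_mem j t ht')).trans ?_
    split_ifs with hj
    · subst hj
      rw [← mul_sub]
      exact mul_le_mul_of_nonneg_left (rpow_y_min_le ht) hB0
    · rw [sub_zero]
      exact mul_le_mul_of_nonneg_left
        (Real.rpow_le_rpow (S.y_mem j t ht').1 (S.y_le j ht') hδ.le) hB0
  calc _ ≤ ∑ j, S.p j * ((B * t ^ (S.γ - S.a) -
        if j = S.jmin then B * ((S.γ - S.a) / 2 * t ^ S.γ) else 0) + A * t ^ S.γ) := by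
        refine Finset.sum_le_sum fun j _ => mul_le_mul_of_nonneg_left ?_ (S.p_pos j).le
        exact add_le_add (hy j) (h.z_term_le hA ht j)
    _ = (∑ j, S.p j) * (B * t ^ (S.γ - S.a) + A * t ^ S.γ) -
          S.p S.jmin * (B * ((S.γ - S.a) / 2 * t ^ S.γ)) := by
        rw [Finset.sum_mul]
        have : S.p S.jmin * (B * ((S.γ - S.a) / 2 * t ^ S.γ)) =
            ∑ j, if j = S.jmin then S.p j * (B * ((S.γ - S.a) / 2 * t ^ S.γ)) else 0 := by
          rw [Finset.sum_ite_eq' Finset.univ S.jmin]; simp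
        rw [this, ← Finset.sum_sub_distrib]
        refine Finset.sum_congr rfl fun j _ => ?_
        split_ifs <;> ring
    _ ≤ _ := by
        rw [S.p_sum]
        nlinarith [mul_le_mul_of_nonneg_right hB htγ0]

theorem Good.push {A B : ℝ} {ν : Measure ℝ} (h : S.Good A B ν) (hA : 6 ≤ A * (1 - S.eta))
    (hA0 : 0 ≤ A)
    (hB : 2 * A ≤ B * (S.p S.jmin * (S.γ - S.a))) (hB0 : 0 ≤ B) : S.Good A B (S.push ν) where
  prob := by
    have := h.prob
    infer_instance
  supp := S.push_supp h.supp
  concave_left := by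
    have := h.prob
    exact S.concave_push h.supp h.concave_left h.concave_right (convex_Icc _ _)
      (Icc_subset_Icc le_rfl (by norm_num)) S.z_concave_left
  concave_right := by
    have := h.prob
    exact S.concave_push h.supp h.concave_left h.concave_right (convex_Icc _ _)
      (Icc_subset_Icc (by norm_num) le_rfl) S.z_concave_right
  bound_right := fun t ht => by
    refine (h.bound_right_push hA0 ht).trans ?_
    exact mul_le_mul_of_nonneg_right (by linarith) (Real.rpow_nonneg ht.1 _)
  bound_left := fun t ht => h.bound_left_push hA0 hB hB0 ht

/-- Away from `0` and `1/2` the measure is dominated by Lebesgue measure. -/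
theorem Good.le_volume {A B : ℝ} {ν : Measure ℝ} (h : S.Good A B ν) {t : ℝ}
    (ht : t ∈ Ioc (0 : ℝ) (1 / 2)) {E : Set ℝ}
    (hE : E ⊆ Ioc t (1 / 2) ∪ Ioc (1 / 2 + t) 1) :
    ν E ≤ ENNReal.ofReal (1 / t) * volume E := by
  have := h.prob
  have piece : ∀ o b : ℝ, o + t ≤ b → ConcaveOn ℝ (Icc o b) (fun t => ν.real (Iic t)) →
      ∀ E ⊆ Ioc (o + t) b, ν E ≤ ENNReal.ofReal (1 / t) * volume E := by
    intro o b hob hconc E hE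
    have hle : ν.restrict (Ioc (o + t) b) ≤
        ENNReal.ofReal (1 / t) • volume.restrict (Ioc (o + t) b) := by
      have : IsFiniteMeasure (ENNReal.ofReal (1 / t) • volume.restrict (Ioc (o + t) b)) :=
        Measure.smul_finite _ ENNReal.ofReal_ne_top
      apply measure_le_of_Ioc
      intro c d hcd
      rw [Measure.smul_apply, Measure.restrict_apply measurableSet_Ioc,
        Measure.restrict_apply measurableSet_Ioc, Ioc_inter_Ioc, Real.volume_Ioc, smul_eq_mul,
        ← ENNReal.ofReal_mul (by have := ht.1; positivity)]
      set c' := c ⊔ (o + t)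
      set d' := d ⊓ b
      rcases le_or_gt d' c' with hdc | hdc
      · rw [Ioc_eq_empty (not_lt.2 hdc)]; simp
      · rw [← ofReal_measureReal]
        apply ENNReal.ofReal_le_ofReal
        have hc' : o + t ≤ c' := le_sup_right
        have hd' : d' ≤ b := inf_le_right
        have h1 := hconc.increment_le (o := o) (a := c') (b := d')
          ⟨le_rfl, by linarith [ht.1]⟩ ⟨by linarith [ht.1], hd'⟩ (by linarith [ht.1]) hdc.le
        have hd : Ioc c' d' = Iic d' \ Iic c' := by
          ext y; simp
        rw [hd, measureReal_sdiff (Iic_subset_Iic.2 hdc.le) measurableSet_Iic]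
        refine h1.trans ?_
        have h2 : ν.real (Iic c') - ν.real (Iic o) ≤ 1 := by
          have : ν.real (Iic c') ≤ 1 := measureReal_le_one
          have : 0 ≤ ν.real (Iic o) := measureReal_nonneg
          linarith
        have h3 : (d' - c') / (c' - o) ≤ 1 / t * (d' - c') := by
          rw [div_eq_mul_one_div, mul_comm]
          refine mul_le_mul_of_nonneg_right ?_ (by linarith)
          exact one_div_le_one_div_of_le ht.1 (by linarith)
        have h4 : 0 ≤ (d' - c') / (c' - o) :=
          div_nonneg (by linarith) (by linarith [ht.1])
        nlinarith
    have := hle E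
    rwa [Measure.smul_apply, Measure.restrict_eq_self _ hE, Measure.restrict_eq_self _ hE] at this
  have h1 := piece 0 (1 / 2) (by linarith [ht.2]) h.concave_left (E ∩ Ioc t (1 / 2))
    (by rw [zero_add]; exact inter_subset_right)
  have h2 := piece (1 / 2) 1 (by linarith [ht.2]) h.concave_right (E ∩ Ioc (1 / 2 + t) 1)
    inter_subset_right
  have hd : Disjoint (Ioc t (1 / 2)) (Ioc (1 / 2 + t) 1) := by
    rw [Set.disjoint_left]
    intro x hx hx'
    linarith [hx.2, hx'.1, ht.1]
  have hEE : E = E ∩ Ioc t (1 / 2) ∪ E ∩ Ioc (1 / 2 + t) 1 := by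
    rw [← inter_union_distrib_left, inter_eq_left.2 hE]
  have hvol : volume (E ∩ Ioc t (1 / 2)) + volume (E ∩ Ioc (1 / 2 + t) 1) = volume E := by
    conv_rhs => rw [hEE]
    have e1 : E ∩ Ioc t (1 / 2) = E \ Ioc (1 / 2 + t) 1 := by
      ext x
      refine ⟨fun hx => ⟨hx.1, fun h' => Set.disjoint_left.1 hd hx.2 h'⟩, fun hx => ⟨hx.1, ?_⟩⟩
      exact (hE hx.1).resolve_right hx.2
    rw [← hEE, add_comm, e1]
    exact measure_inter_add_sdiff E measurableSet_Ioc
  calc ν E ≤ ν (E ∩ Ioc t (1 / 2)) + ν (E ∩ Ioc (1 / 2 + t) 1) := by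
        conv_lhs => rw [hEE]
        exact measure_union_le _ _
    _ ≤ _ := add_le_add h1 h2
    _ = _ := by rw [← mul_add, hvol]

/-- Uniform integrability of the class of good measures. -/
theorem exists_uniform_bound (S : RandomSystem N) (A B : ℝ) {ε : ℝ} (hε : 0 < ε) :
    ∃ C : ℝ, 0 ≤ C ∧ ∀ ν : Measure ℝ, S.Good A B ν → ∀ E ⊆ Icc (0 : ℝ) 1,
      ν.real E ≤ ε + C * volume.real E := by
  have hδ : 0 < S.γ - S.a := sub_pos.2 S.a_lt
  have lim : ∀ c q : ℝ, 0 < q → Tendsto (fun t : ℝ => c * t ^ q) (𝓝[>] 0) (𝓝 0) := by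
    intro c q hq
    have : ContinuousAt (fun t : ℝ => c * t ^ q) 0 :=
      continuousAt_const.mul (Real.continuousAt_rpow_const _ _ (Or.inr hq.le))
    have h := this.tendsto
    rw [Real.zero_rpow hq.ne', mul_zero] at h
    exact h.mono_left nhdsWithin_le_nhds
  have e1 := (lim A S.γ γ_pos).eventually (gt_mem_nhds (half_pos hε))
  have e2 := (lim B _ hδ).eventually (gt_mem_nhds (half_pos hε))
  have e3 : ∀ᶠ t : ℝ in 𝓝[>] 0, t ∈ Ioc (0 : ℝ) (1 / 2) :=
    Ioc_mem_nhdsGT (by norm_num)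
  obtain ⟨t, h1, h2, ht⟩ := (e1.and (e2.and e3)).exists
  refine ⟨1 / t, by have := ht.1; positivity, fun ν h E hE => ?_⟩
  have := h.prob
  have hvE : volume E ≠ ⊤ := ((measure_mono hE).trans_lt (by simp)).ne
  set M := E ∩ (Ioc t (1 / 2) ∪ Ioc (1 / 2 + t) 1)
  have hsub : E ⊆ Iic t ∪ (Iic (1 / 2 + t) \ Iic (1 / 2)) ∪ M := by
    intro x hx
    have := hE hx
    by_cases a1 : x ≤ t
    · exact Or.inl (Or.inl a1)
    by_cases a2 : x ≤ 1 / 2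
    · exact Or.inr ⟨hx, Or.inl ⟨not_le.1 a1, a2⟩⟩
    by_cases a3 : x ≤ 1 / 2 + t
    · exact Or.inl (Or.inr ⟨a3, a2⟩)
    · exact Or.inr ⟨hx, Or.inr ⟨not_le.1 a3, this.2⟩⟩
  have hM : ν.real M ≤ 1 / t * volume.real E := by
    have h3 := h.le_volume ht (E := M) inter_subset_right
    have h4 : ν M ≤ ENNReal.ofReal (1 / t) * volume E :=
      h3.trans (by gcongr; exact inter_subset_left)
    have h5 := ENNReal.toReal_mono (ENNReal.mul_ne_top ENNReal.ofReal_ne_top hvE) h4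
    rwa [ENNReal.toReal_mul, ENNReal.toReal_ofReal (by have := ht.1; positivity)] at h5
  have hb1 := h.bound_left t ⟨ht.1.le, ht.2⟩
  have hb2 := h.bound_right t ⟨ht.1.le, ht.2⟩
  rw [← measureReal_sdiff (Iic_subset_Iic.2 (by linarith [ht.1])) measurableSet_Iic] at hb2
  have := measureReal_mono (μ := ν) hsub
  have := measureReal_union_le (μ := ν) (Iic t ∪ (Iic (1 / 2 + t) \ Iic (1 / 2))) M
  have := measureReal_union_le (μ := ν) (Iic t) (Iic (1 / 2 + t) \ Iic (1 / 2))
  linarith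

end RandomSystem

/-- Existence of Banach limits. -/
theorem exists_banach_limit : ∃ L : (ℕ → ℝ) → ℝ,
    (∀ (a b : ℕ → ℝ) (C : ℝ), (∀ k, |a k| ≤ C) → (∀ k, |b k| ≤ C) →
      L (fun k => a k + b k) = L a + L b) ∧
    (∀ (a : ℕ → ℝ) (c C : ℝ), (∀ k, |a k| ≤ C) → L (fun k => c * a k) = c * L a) ∧
    (∀ (a b : ℕ → ℝ) (C : ℝ), (∀ k, |a k| ≤ C) → (∀ k, |b k| ≤ C) → (∀ k, a k ≤ b k) →
      L a ≤ L b) ∧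
    (∀ (a : ℕ → ℝ) (C : ℝ), (∀ k, |a k| ≤ C) → L (fun k => a (k + 1)) = L a) ∧
    (∀ c : ℝ, L (fun _ => c) = c) := by
  let m : (ℕ → ℝ) → ℕ → ℝ := fun a n => (∑ k ∈ Finset.range (n + 1), a k) / (n + 1)
  let U : Filter ℕ := hyperfilter ℕ
  have hU : U ≤ atTop := by
    rw [← Nat.cofinite_eq_atTop]; exact hyperfilter_le_cofinite
  let L : (ℕ → ℝ) → ℝ := fun a => limUnder U (m a)
  have hpos : ∀ n : ℕ, (0 : ℝ) < n + 1 := fun n => by positivity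
  have hL : ∀ (a : ℕ → ℝ) (C : ℝ), (∀ k, |a k| ≤ C) → Tendsto (m a) U (𝓝 (L a)) := by
    intro a C ha
    have hm : ∀ n, m a n ∈ Icc (-C) C := by
      intro n
      rw [mem_Icc, ← abs_le]
      simp only [m]
      rw [abs_div, abs_of_pos (hpos n), div_le_iff₀ (hpos n)]
      refine (Finset.abs_sum_le_sum_abs _ _).trans ?_
      refine (Finset.sum_le_sum fun k _ => ha k).trans ?_
      simp [mul_comm]
    obtain ⟨l, -, hl⟩ := (isCompact_Icc (a := -C) (b := C)).ultrafilter_le_nhds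
      ((hyperfilter ℕ).map (m a)) (by
        rw [le_principal_iff]; exact Filter.mem_map.2 (Filter.univ_mem' hm))
    exact tendsto_nhds_limUnder ⟨l, hl⟩
  have hne : U.NeBot := inferInstanceAs (hyperfilter ℕ : Filter ℕ).NeBot
  refine ⟨L, ?_, ?_, ?_, ?_, ?_⟩
  · intro a b C ha hb
    have h1 := (hL a C ha).add (hL b C hb)
    have h2 := hL (fun k => a k + b k) (C + C)
      fun k => (abs_add_le _ _).trans (add_le_add (ha k) (hb k))
    refine tendsto_nhds_unique h2 (h1.congr fun n => ?_)
    simp only [m, Finset.sum_add_distrib, add_div]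
  · intro a c C ha
    have h1 := (hL a C ha).const_mul c
    have h2 := hL (fun k => c * a k) (|c| * C)
      fun k => by rw [abs_mul]; exact mul_le_mul_of_nonneg_left (ha k) (abs_nonneg _)
    refine tendsto_nhds_unique h2 (h1.congr fun n => ?_)
    simp only [m, ← Finset.mul_sum, mul_div_assoc]
  · intro a b C ha hb hab
    refine le_of_tendsto_of_tendsto' (hL a C ha) (hL b C hb) fun n => ?_
    exact div_le_div_of_nonneg_right (Finset.sum_le_sum fun k _ => hab k) (hpos n).le
  · intro a C ha
    have h1 := hL a C ha
    have h2 := hL (fun k => a (k + 1)) C fun k => ha _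
    have h3 : Tendsto (fun n : ℕ => (2 * C) / ((n : ℝ) + 1)) U (𝓝 0) := by
      have := (tendsto_const_div_atTop_nhds_zero_nat (2 * C)).comp (tendsto_add_atTop_nat 1)
      refine (this.congr fun n => ?_).mono_left hU
      simp
    have h4 : Tendsto (fun n => m (fun k => a (k + 1)) n - m a n) U (𝓝 0) := by
      refine squeeze_zero_norm (fun n => ?_) h3
      simp only [m]
      rw [← sub_div, ← Finset.sum_sub_distrib, Finset.sum_range_sub, Real.norm_eq_abs, abs_div,
        abs_of_pos (hpos n)]
      refine div_le_div_of_nonneg_right ?_ (hpos n).le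
      have := abs_sub (a (n + 1)) (a 0)
      linarith [ha (n + 1), ha 0]
    have := tendsto_nhds_unique h4 (h2.sub h1)
    linarith
  · intro c
    have h1 := hL (fun _ => c) |c| fun _ => le_rfl
    refine tendsto_nhds_unique h1 (tendsto_const_nhds.congr fun n => ?_)
    simp only [m, Finset.sum_const, Finset.card_range, nsmul_eq_mul, Nat.cast_add, Nat.cast_one]
    field_simp [(hpos n).ne']

/-- A setwise Banach limit of a uniformly integrable sequence of probability measures on the unit
interval is an absolutely continuous probability measure. -/
theorem exists_limit_measure {L : (ℕ → ℝ) → ℝ}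
    (L_add : ∀ (a b : ℕ → ℝ) (C : ℝ), (∀ k, |a k| ≤ C) → (∀ k, |b k| ≤ C) →
      L (fun k => a k + b k) = L a + L b)
    (L_mono : ∀ (a b : ℕ → ℝ) (C : ℝ), (∀ k, |a k| ≤ C) → (∀ k, |b k| ≤ C) → (∀ k, a k ≤ b k) →
      L a ≤ L b)
    (L_const : ∀ c : ℝ, L (fun _ => c) = c)
    (μ : ℕ → Measure ℝ) [∀ k, IsProbabilityMeasure (μ k)] (hsupp : ∀ k, μ k (Icc 0 1)ᶜ = 0)
    (hui : ∀ ε > 0, ∃ C : ℝ, 0 ≤ C ∧ ∀ k, ∀ E ⊆ Icc (0 : ℝ) 1,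
      (μ k).real E ≤ ε + C * volume.real E) :
    ∃ ν : Measure ℝ, IsProbabilityMeasure ν ∧
      ∀ E, MeasurableSet E → ν.real E = L fun k => (μ k).real E := by
  have bd : ∀ E k, |(μ k).real E| ≤ 1 := fun E k => by
    rw [abs_of_nonneg measureReal_nonneg]; exact measureReal_le_one
  set M : Set ℝ → ℝ := fun E => L fun k => (μ k).real E with hM
  have M_nonneg : ∀ E, 0 ≤ M E := fun E => by
    rw [← L_const 0]
    exact L_mono _ _ 1 (by simp) (bd E) fun k => measureReal_nonneg
  have M_union : ∀ E F, Disjoint E F → MeasurableSet F → M (E ∪ F) = M E + M F := by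
    intro E F hd hF
    rw [hM]
    simp only
    rw [← L_add _ _ 1 (bd E) (bd F)]
    refine congrArg L (funext fun k => ?_)
    exact measureReal_union hd hF
  have M_empty : M ∅ = 0 := by simp [hM, L_const]
  have M_small : ∀ ε > 0, ∃ C : ℝ, 0 ≤ C ∧ ∀ E, MeasurableSet E →
      M E ≤ ε + C * (volume.restrict (Icc 0 1)).real E := by
    intro ε hε
    obtain ⟨C, hC, h⟩ := hui ε hε
    refine ⟨C, hC, fun E hE => ?_⟩
    set c := ε + C * (volume.restrict (Icc 0 1)).real E
    have hle : ∀ k, (μ k).real E ≤ c := by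
      intro k
      have h1 := h k (E ∩ Icc 0 1) inter_subset_right
      have h2 : (μ k).real (E ∩ Icc 0 1) = (μ k).real E := by
        refine measureReal_congr ?_
        have h' : ∀ᵐ x ∂(μ k), x ∈ Icc (0 : ℝ) 1 := hsupp k
        filter_upwards [h'] with x hx
        exact propext ⟨fun h => h.1, fun h => ⟨h, hx⟩⟩
      rw [h2] at h1
      refine h1.trans (le_of_eq ?_)
      simp only [c, measureReal_restrict_apply hE]
    rw [← L_const c]
    exact L_mono _ _ (max 1 |c|) (fun k => (bd E k).trans (le_max_left _ _))
      (fun _ => le_max_right _ _) hle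
  have M_sum : ∀ f : ℕ → Set ℝ, (∀ i, MeasurableSet (f i)) → Pairwise (Function.onFun Disjoint f) →
      HasSum (fun i => M (f i)) (M (⋃ i, f i)) := by
    intro f hf hd
    rw [hasSum_iff_tendsto_nat_of_nonneg fun i => M_nonneg _]
    have hfin : ∀ n, ∑ i ∈ Finset.range n, M (f i) = M (⋃ i, f i) - M (⋃ i ≥ n, f i) := by
      intro n
      induction n with
      | zero => simp
      | succ n ih =>
        have h1 : (⋃ i ≥ n, f i) = (⋃ i ≥ n + 1, f i) ∪ f n := by
          ext x
          simp only [mem_iUnion, mem_union, exists_prop, ge_iff_le]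
          constructor
          · rintro ⟨i, hi, hx⟩
            rcases hi.eq_or_lt with rfl | hlt
            · exact Or.inr hx
            · exact Or.inl ⟨i, hlt, hx⟩
          · rintro (⟨i, hi, hx⟩ | hx)
            · exact ⟨i, by omega, hx⟩
            · exact ⟨n, le_rfl, hx⟩
        have h2 : Disjoint (⋃ i ≥ n + 1, f i) (f n) := by
          simp only [disjoint_iUnion_left]
          intro i hi
          exact hd (by omega)
        rw [Finset.sum_range_succ, ih, h1, M_union _ _ h2 (hf n)]
        ring
    have htail : Tendsto (fun n => M (⋃ i ≥ n, f i)) atTop (𝓝 0) := by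
      have hv := tendsto_measure_biUnion_Ici_zero_of_pairwise_disjoint
        (μ := volume.restrict (Icc (0 : ℝ) 1)) (fun i => (hf i).nullMeasurableSet) hd
      have hv' := (ENNReal.tendsto_toReal ENNReal.zero_ne_top).comp hv
      rw [Metric.tendsto_atTop]
      intro ε hε
      obtain ⟨C, hC, h⟩ := M_small (ε / 2) (half_pos hε)
      have h3 := (hv'.const_mul C)
      rw [ENNReal.toReal_zero, mul_zero] at h3
      obtain ⟨n₀, hn₀⟩ := (h3.eventually (gt_mem_nhds (half_pos hε))).exists_forall_of_atTop
      refine ⟨n₀, fun n hn => ?_⟩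
      have h4 := h (⋃ i ≥ n, f i) (MeasurableSet.iUnion fun i => MeasurableSet.iUnion fun _ => hf i)
      have h5 : C * (volume.restrict (Icc (0 : ℝ) 1)).real (⋃ i ≥ n, f i) < ε / 2 := hn₀ n hn
      rw [dist_zero_right, Real.norm_eq_abs, abs_of_nonneg (M_nonneg _)]
      linarith
    have := (tendsto_const_nhds (x := M (⋃ i, f i))).sub htail
    rw [sub_zero] at this
    exact this.congr fun n => (hfin n).symm
  let ν := Measure.ofMeasurable (fun E _ => ENNReal.ofReal (M E)) (by simp [M_empty]) (by
    intro f hf hd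
    rw [← (M_sum f hf hd).tsum_eq, ENNReal.ofReal_tsum_of_nonneg (fun i => M_nonneg _)
      (M_sum f hf hd).summable])
  have hν : ∀ E, MeasurableSet E → ν E = ENNReal.ofReal (M E) := fun E hE =>
    Measure.ofMeasurable_apply E hE
  refine ⟨ν, ⟨?_⟩, fun E hE => ?_⟩
  · rw [hν _ MeasurableSet.univ]
    simp [hM, L_const]
  · rw [Measure.real, hν E hE, ENNReal.toReal_ofReal (M_nonneg E)]

namespace RandomSystem

variable {N : ℕ} {S : RandomSystem N}

theorem Good.mono {A A' B B' : ℝ} {ν : Measure ℝ} (h : S.Good A B ν) (hA : A ≤ A') (hB : B ≤ B') :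
    S.Good A' B' ν where
  prob := h.prob
  supp := h.supp
  concave_left := h.concave_left
  concave_right := h.concave_right
  bound_right t ht := (h.bound_right t ht).trans
    (mul_le_mul_of_nonneg_right hA (Real.rpow_nonneg ht.1 _))
  bound_left t ht := (h.bound_left t ht).trans
    (mul_le_mul_of_nonneg_right hB (Real.rpow_nonneg ht.1 _))

theorem supp_Icc {ν : Measure ℝ} (h : ν (Ioc 0 1)ᶜ = 0) : ν (Icc 0 1)ᶜ = 0 :=
  measure_mono_null (compl_subset_compl.2 Ioc_subset_Icc_self) h

theorem Good.absolutelyContinuous {A B : ℝ} {ν : Measure ℝ} (h : S.Good A B ν) :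
    ν ≪ volume.restrict (Icc (0 : ℝ) 1) := by
  have := h.prob
  refine Measure.AbsolutelyContinuous.mk fun E hE h0 => ?_
  rw [Measure.restrict_apply hE] at h0
  have h1 : ν.real (E ∩ Icc 0 1) ≤ 0 := by
    refine le_of_forall_pos_le_add fun ε hε => ?_
    obtain ⟨C, -, hC⟩ := S.exists_uniform_bound A B hε
    have := hC ν h (E ∩ Icc 0 1) inter_subset_right
    rw [measureReal_def (μ := volume), h0, ENNReal.toReal_zero, mul_zero, add_zero] at this
    rwa [zero_add]
  have h2 : ν (E ∩ Icc 0 1) = 0 := by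
    rw [← measureReal_eq_zero_iff]
    exact le_antisymm h1 measureReal_nonneg
  refine measure_mono_null (t := E ∩ Icc 0 1 ∪ (Icc 0 1)ᶜ) ?_
    (measure_union_null h2 (supp_Icc h.supp))
  intro x hx
  by_cases hx' : x ∈ Icc (0 : ℝ) 1
  · exact Or.inl ⟨hx, hx'⟩
  · exact Or.inr hx'

/-- Iterating the dual operator from a good measure and averaging yields a good stationary measure
which inherits uniform upper bounds on sets. -/
theorem exists_stationary (S : RandomSystem N) {A B : ℝ} {ν₀ : Measure ℝ} (h₀ : S.Good A B ν₀)
    (hA : 6 ≤ A * (1 - S.eta)) (hA0 : 0 ≤ A)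
    (hB : 2 * A ≤ B * (S.p S.jmin * (S.γ - S.a))) (hB0 : 0 ≤ B) :
    ∃ ν : Measure ℝ, S.Good A B ν ∧ S.push ν = ν ∧
      ∀ E, MeasurableSet E → ∀ ε, (∀ k, (S.push^[k] ν₀).real E ≤ ε) → ν.real E ≤ ε := by
  obtain ⟨L, L_add, L_mul, L_mono, L_shift, L_const⟩ := exists_banach_limit
  have good : ∀ k, S.Good A B (S.push^[k] ν₀) := by
    intro k
    induction k with
    | zero => exact h₀
    | succ k ih =>
      rw [Function.iterate_succ_apply']
      exact ih.push hA hA0 hB hB0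
  have prob : ∀ k, IsProbabilityMeasure (S.push^[k] ν₀) := fun k => (good k).prob
  have bd : ∀ E k, |(S.push^[k] ν₀).real E| ≤ 1 := fun E k => by
    rw [abs_of_nonneg measureReal_nonneg]; exact measureReal_le_one
  obtain ⟨ν, hprob, hν⟩ := exists_limit_measure L_add L_mono L_const (fun k => S.push^[k] ν₀)
    (fun k => supp_Icc (good k).supp) (fun ε hε => by
      obtain ⟨C, hC, h⟩ := S.exists_uniform_bound A B hε
      exact ⟨C, hC, fun k => h _ (good k)⟩)
  have le_of : ∀ E, MeasurableSet E → ∀ ε, (∀ k, (S.push^[k] ν₀).real E ≤ ε) → ν.real E ≤ ε := by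
    intro E hE ε h
    rw [hν E hE, ← L_const ε]
    exact L_mono _ _ (max 1 |ε|) (fun k => (bd E k).trans (le_max_left _ _))
      (fun _ => le_max_right _ _) h
  have conc : ∀ I : Set ℝ, (∀ k, ConcaveOn ℝ I fun t => (S.push^[k] ν₀).real (Iic t)) →
      ConcaveOn ℝ I fun t => ν.real (Iic t) := by
    intro I hI
    refine ⟨(hI 0).1, fun x hx y hy u v hu hv huv => ?_⟩
    simp only [hν _ measurableSet_Iic, smul_eq_mul]
    have hb : ∀ (w : ℝ) (E : Set ℝ), 0 ≤ w → w ≤ 1 → ∀ k, |w * (S.push^[k] ν₀).real E| ≤ 1 := by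
      intro w E h0 h1 k
      rw [abs_mul, abs_of_nonneg h0]
      exact mul_le_one₀ h1 (abs_nonneg _) (bd E k)
    rw [← L_mul _ u 1 (bd _), ← L_mul _ v 1 (bd _),
      ← L_add _ _ 1 (hb u _ hu (by linarith)) (hb v _ hv (by linarith))]
    refine L_mono _ _ 2 (fun k => ?_) (fun k => (bd _ k).trans (by norm_num)) fun k => ?_
    · refine (abs_add_le _ _).trans ?_
      linarith [hb u (Iic x) hu (by linarith) k, hb v (Iic y) hv (by linarith) k]
    · exact (hI k).2 hx hy hu hv huv
  have L_sum : ∀ (s : Finset (Fin N)) (E : Fin N → Set ℝ),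
      (L fun k => ∑ j ∈ s, S.p j * (S.push^[k] ν₀).real (E j)) =
        ∑ j ∈ s, S.p j * L fun k => (S.push^[k] ν₀).real (E j) := by
    intro s E
    induction s using Finset.cons_induction with
    | empty => simpa using L_const 0
    | cons i s hi ih =>
      simp only [Finset.sum_cons]
      have hb : ∀ j k, |S.p j * (S.push^[k] ν₀).real (E j)| ≤ S.p j := by
        intro j k
        rw [abs_mul, abs_of_pos (S.p_pos j)]
        exact mul_le_of_le_one_right (S.p_pos j).le (bd _ _)
      have hs : 0 ≤ ∑ j ∈ s, S.p j := Finset.sum_nonneg fun j _ => (S.p_pos j).le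
      rw [L_add _ _ (S.p i + ∑ j ∈ s, S.p j), ih, L_mul _ _ 1 (bd _)]
      · exact fun k => (hb i k).trans (by linarith)
      · intro k
        refine (Finset.abs_sum_le_sum_abs _ _).trans ((Finset.sum_le_sum fun j _ => hb j k).trans ?_)
        linarith [(S.p_pos i).le]
  have stat : S.push ν = ν := by
    ext E hE
    rw [← measureReal_eq_measureReal_iff, S.push_real ν hE, hν E hE, ← L_shift _ 1 (bd E)]
    rw [Finset.sum_congr rfl fun j _ => by rw [hν _ (S.meas j hE)], ← L_sum]
    congr 1
    ext k
    rw [Function.iterate_succ_apply', S.push_real _ hE]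
  refine ⟨ν, ?_, stat, le_of⟩
  refine ⟨hprob, ?_, conc _ fun k => (good k).concave_left, conc _ fun k => (good k).concave_right,
    ?_, ?_⟩
  · rw [← measureReal_eq_zero_iff]
    refine le_antisymm (le_of _ measurableSet_Ioc.compl 0 fun k => ?_) measureReal_nonneg
    rw [Measure.real, (good k).supp, ENNReal.toReal_zero]
  · intro t ht
    rw [← measureReal_sdiff (Iic_subset_Iic.2 (by linarith [ht.1])) measurableSet_Iic]
    refine le_of _ (measurableSet_Iic.diff measurableSet_Iic) _ fun k => ?_
    rw [measureReal_sdiff (Iic_subset_Iic.2 (by linarith [ht.1])) measurableSet_Iic]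
    exact (good k).bound_right t ht
  · exact fun t ht => le_of _ measurableSet_Iic _ fun k => (good k).bound_left t ht

theorem one_sub_eta_pos (S : RandomSystem N) : 0 < 1 - S.eta := sub_pos.2 S.eta_lt

/-- The universal constant in the bound at `1/2`. -/
noncomputable def A₀ (S : RandomSystem N) : ℝ := 6 / (1 - S.eta)

/-- The universal constant in the bound at `0`. -/
noncomputable def B₀ (S : RandomSystem N) : ℝ := 2 * S.A₀ / (S.p S.jmin * (S.γ - S.a))

theorem A₀_pos (S : RandomSystem N) : 0 < S.A₀ := div_pos (by norm_num) S.one_sub_eta_pos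

theorem pδ_pos (S : RandomSystem N) : 0 < S.p S.jmin * (S.γ - S.a) :=
  mul_pos (S.p_pos _) (sub_pos.2 S.a_lt)

theorem B₀_pos (S : RandomSystem N) : 0 < S.B₀ :=
  div_pos (by linarith [S.A₀_pos]) S.pδ_pos

theorem Good.universal_right {A B : ℝ} {ν : Measure ℝ} (h : S.Good A B ν) (hst : S.push ν = ν)
    (hA : 0 ≤ A) : S.Good S.A₀ B ν := by
  have hη := S.eta_nonneg
  have hη1 := S.one_sub_eta_pos
  have hA₀ : 6 + S.eta * S.A₀ = S.A₀ := by
    have : S.A₀ * (1 - S.eta) = 6 := div_mul_cancel₀ _ hη1.ne'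
    linarith
  have step : ∀ n : ℕ, S.Good (S.A₀ + S.eta ^ n * A) B ν := by
    intro n
    induction n with
    | zero => exact h.mono (by have := S.A₀_pos; simp; exact this.le) le_rfl
    | succ n ih =>
      refine { h with bound_right := fun t ht => ?_ }
      have h1 := ih.bound_right_push (add_nonneg S.A₀_pos.le (by positivity)) ht
      rw [hst] at h1
      refine h1.trans (le_of_eq ?_)
      congr 1
      rw [pow_succ]
      linear_combination hA₀
  refine { h with bound_right := fun t ht => ?_ }
  have hlim : Tendsto (fun n : ℕ => (S.A₀ + S.eta ^ n * A) * t ^ S.γ) atTop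
      (𝓝 ((S.A₀ + 0 * A) * t ^ S.γ)) :=
    (((tendsto_pow_atTop_nhds_zero_of_lt_one hη (by linarith)).mul_const A).const_add _).mul_const _
  rw [zero_mul, add_zero] at hlim
  exact ge_of_tendsto' hlim fun n => (step n).bound_right t ht

theorem Good.universal_left {B : ℝ} {ν : Measure ℝ} (h : S.Good S.A₀ B ν) (hst : S.push ν = ν) :
    S.Good S.A₀ S.B₀ ν := by
  have := h.prob
  have hδ : 0 < S.γ - S.a := sub_pos.2 S.a_lt
  have hp := S.p_pos S.jmin
  have step : ∀ t ∈ Icc (0 : ℝ) (1 / 2), ν.real (Iic t) - S.B₀ * t ^ (S.γ - S.a) ≤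
      ν.real (Iic (S.y S.jmin t)) - S.B₀ * S.y S.jmin t ^ (S.γ - S.a) := by
    intro t ht
    have ht' : t ∈ Icc (0 : ℝ) 1 := ⟨ht.1, by linarith [ht.2]⟩
    have h1 : ν.real (Iic t) = (S.push ν).real (Iic t) := by rw [hst]
    rw [S.push_Iic ν h.supp ht'] at h1
    have h2 : ν.real (Iic t) ≤ ∑ j, S.p j * ((ν.real (Iic t) -
        if j = S.jmin then ν.real (Iic t) - ν.real (Iic (S.y j t)) else 0) +
          S.A₀ * t ^ S.γ) := by
      conv_lhs => rw [h1]
      refine Finset.sum_le_sum fun j _ => mul_le_mul_of_nonneg_left ?_ (S.p_pos j).le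
      refine add_le_add ?_ (h.z_term_le S.A₀_pos.le ht j)
      split_ifs
      · linarith
      · rw [sub_zero]
        exact monotone_Iic ν (S.y_le j ht')
    have h3 : ∑ j, S.p j * ((ν.real (Iic t) -
        if j = S.jmin then ν.real (Iic t) - ν.real (Iic (S.y j t)) else 0) +
          S.A₀ * t ^ S.γ) = (∑ j, S.p j) * (ν.real (Iic t) + S.A₀ * t ^ S.γ) -
          S.p S.jmin * (ν.real (Iic t) - ν.real (Iic (S.y S.jmin t))) := by
      have : S.p S.jmin * (ν.real (Iic t) - ν.real (Iic (S.y S.jmin t))) =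
          ∑ j, if j = S.jmin then S.p j * (ν.real (Iic t) - ν.real (Iic (S.y j t))) else 0 := by
        rw [Finset.sum_ite_eq' Finset.univ S.jmin]; simp
      rw [this, Finset.sum_mul, ← Finset.sum_sub_distrib]
      refine Finset.sum_congr rfl fun j _ => ?_
      split_ifs <;> ring
    rw [h3, S.p_sum] at h2
    have h4 := mul_le_mul_of_nonneg_left (rpow_y_min_le (S := S) ht) S.B₀_pos.le
    have h5 : S.p S.jmin * (S.B₀ * ((S.γ - S.a) / 2)) = S.A₀ := by
      have : S.B₀ * (S.p S.jmin * (S.γ - S.a)) = 2 * S.A₀ := div_mul_cancel₀ _ S.pδ_pos.ne'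
      linarith
    have h6 : S.p S.jmin * (ν.real (Iic t) - ν.real (Iic (S.y S.jmin t))) ≤
        S.p S.jmin * (S.B₀ * ((S.γ - S.a) / 2 * t ^ S.γ)) := by
      rw [show S.p S.jmin * (S.B₀ * ((S.γ - S.a) / 2 * t ^ S.γ)) =
        S.p S.jmin * (S.B₀ * ((S.γ - S.a) / 2)) * t ^ S.γ by ring, h5]
      linarith
    have h7 := le_of_mul_le_mul_left h6 hp
    linarith
  refine { h with bound_left := fun t ht => ?_ }
  by_contra! hcon
  set d := ν.real (Iic t) - S.B₀ * t ^ (S.γ - S.a) with hd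
  have hd0 : 0 < d := sub_pos.2 hcon
  set x : ℕ → ℝ := fun n => (S.y S.jmin)^[n] t with hx
  have xs : ∀ n, x (n + 1) = S.y S.jmin (x n) := fun n => Function.iterate_succ_apply' _ _ _
  have hxm : ∀ n, x n ∈ Icc (0 : ℝ) (1 / 2) ∧
      d ≤ ν.real (Iic (x n)) - S.B₀ * x n ^ (S.γ - S.a) := by
    intro n
    induction n with
    | zero => exact ⟨ht, le_rfl⟩
    | succ n ih =>
      rw [xs]
      have hh : x n ∈ Icc (0 : ℝ) 1 := ⟨ih.1.1, by linarith [ih.1.2]⟩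
      exact ⟨S.y_mem _ _ hh, ih.2.trans (step _ ih.1)⟩
  have hBx : ∀ n, d ≤ B * x n ^ (S.γ - S.a) := by
    intro n
    have h1 := h.bound_left _ (hxm n).1
    have h2 : 0 ≤ S.B₀ * x n ^ (S.γ - S.a) :=
      mul_nonneg S.B₀_pos.le (Real.rpow_nonneg (hxm n).1.1 _)
    linarith [(hxm n).2]
  have hBpos : 0 < B := by
    by_contra! hB
    have := Real.rpow_nonneg (hxm 0).1.1 (S.γ - S.a)
    nlinarith [hBx 0]
  set σ := (d / B) ^ (S.γ - S.a)⁻¹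
  have hσ : 0 < σ := Real.rpow_pos_of_pos (div_pos hd0 hBpos) _
  have hσx : ∀ n, σ ≤ x n := by
    intro n
    rw [Real.rpow_inv_le_iff_of_pos (div_pos hd0 hBpos).le (hxm n).1.1 hδ, div_le_iff₀ hBpos]
    linarith [hBx n]
  have hdec : ∀ n : ℕ, x n ≤ 1 / 2 - n * (σ * σ ^ S.a / 2) := by
    intro n
    induction n with
    | zero =>
      rw [Nat.cast_zero, zero_mul, sub_zero]
      exact ht.2
    | succ n ih =>
      have hh : x n ∈ Icc (0 : ℝ) 1 := ⟨(hxm n).1.1, by linarith [(hxm n).1.2]⟩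
      have h1 := S.y_min _ hh
      have h2 : σ * σ ^ S.a ≤ x n * x n ^ S.a :=
        mul_le_mul (hσx n) (Real.rpow_le_rpow hσ.le (hσx n) S.a_pos.le)
          (Real.rpow_nonneg hσ.le _) (hxm n).1.1
      rw [xs]
      push_cast
      nlinarith
  have hq : 0 < σ * σ ^ S.a / 2 := by
    have := Real.rpow_pos_of_pos hσ S.a
    positivity
  obtain ⟨n, hn⟩ := exists_nat_gt (1 / (σ * σ ^ S.a / 2))
  rw [div_lt_iff₀ hq] at hn
  linarith [hdec n, hσx n]

/-- Good stationary measures are uniformly bounded below by Lebesgue measure near `0`. -/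
theorem exists_lower_bound (S : RandomSystem N) : ∃ c δ : ℝ, 0 < c ∧ 0 < δ ∧ δ < 1 / 2 ∧
    ∀ (A B : ℝ) (ν : Measure ℝ), 0 ≤ A → S.Good A B ν → S.push ν = ν →
      ∀ E ⊆ Ioc 0 δ, ENNReal.ofReal c * volume E ≤ ν E := by
  have lim : ∀ c q : ℝ, 0 < q → Tendsto (fun t : ℝ => c * t ^ q) (𝓝[>] 0) (𝓝 0) := by
    intro c q hq
    have : ContinuousAt (fun t : ℝ => c * t ^ q) 0 :=
      continuousAt_const.mul (Real.continuousAt_rpow_const _ _ (Or.inr hq.le))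
    have h := this.tendsto
    rw [Real.zero_rpow hq.ne', mul_zero] at h
    exact h.mono_left nhdsWithin_le_nhds
  have e1 := (lim S.A₀ S.γ γ_pos).eventually (gt_mem_nhds (show (0 : ℝ) < 1 / 4 by norm_num))
  have e2 := (lim S.B₀ _ (sub_pos.2 S.a_lt)).eventually
    (gt_mem_nhds (show (0 : ℝ) < 1 / 4 by norm_num))
  have e3 : ∀ᶠ t : ℝ in 𝓝[>] 0, t ∈ Ioo (0 : ℝ) (1 / 2) := Ioo_mem_nhdsGT (by norm_num)
  obtain ⟨δ, h1, h2, hδ⟩ := (e1.and (e2.and e3)).exists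
  have hps := S.p_pos S.s
  have hps1 : S.p S.s ≤ 1 := by
    rw [← S.p_sum]
    exact Finset.single_le_sum (fun j _ => (S.p_pos j).le) (Finset.mem_univ _)
  refine ⟨S.p S.s / 4, δ, by positivity, hδ.1, hδ.2, fun A B ν hA h' hst E hE => ?_⟩
  have h := (h'.universal_right hst hA).universal_left hst
  have := h.prob
  have hmono := monotone_Iic ν
  have hb1 := h.bound_right δ ⟨hδ.1.le, hδ.2.le⟩
  have hb2 := h.bound_left δ ⟨hδ.1.le, hδ.2.le⟩
  have hone := real_Iic_one h.supp
  have key : ∀ u ∈ Icc 0 δ, ∀ t ∈ Icc 0 δ, u ≤ t →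
      S.p S.s / 4 * (t - u) ≤ ν.real (Iic t) - ν.real (Iic u) := by
    intro u hu t ht hut
    rcases le_or_gt (1 / 4) (ν.real (Iic (1 / 2)) - ν.real (Iic δ)) with hc | hc
    · refine h.concave_left.le_increment (a := δ) (b := 1 / 2) ⟨hu.1, by linarith [hu.2, hδ.2]⟩
        ⟨ht.1, by linarith [ht.2, hδ.2]⟩ ⟨hδ.1.le, hδ.2.le⟩ ⟨by norm_num, le_rfl⟩ hut ht.2 hδ.2 ?_
      rw [le_div_iff₀ (by linarith [hδ.2])]
      nlinarith [hδ.1, hδ.2]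
    · have hr : ∀ j, 0 ≤ ν.real (Iic (S.z j t)) - ν.real (Iic (S.z j u)) ∧
          0 ≤ ν.real (Iic (S.y j t)) - ν.real (Iic (S.y j u)) := by
        intro j
        have hu' : u ∈ Icc (0 : ℝ) 1 := ⟨hu.1, by linarith [hu.2, hδ.2]⟩
        have ht' : t ∈ Icc (0 : ℝ) 1 := ⟨ht.1, by linarith [ht.2, hδ.2]⟩
        exact ⟨sub_nonneg.2 (hmono (S.z_mono j hu' ht' hut)),
          sub_nonneg.2 (hmono (S.y_mono j hu' ht' hut))⟩
      have hu' : u ∈ Icc (0 : ℝ) 1 := ⟨hu.1, by linarith [hu.2, hδ.2]⟩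
      have ht' : t ∈ Icc (0 : ℝ) 1 := ⟨ht.1, by linarith [ht.2, hδ.2]⟩
      have hs : 1 / 4 * (t - u) ≤ ν.real (Iic (S.z S.s t)) - ν.real (Iic (S.z S.s u)) := by
        rw [S.z_S _ S.s_notMem t ht', S.z_S _ S.s_notMem u hu']
        have := h.concave_right.le_increment (s := (1 + u) / 2) (t := (1 + t) / 2)
          (a := 1 / 2 + δ) (b := 1) (c := 1 / 2) ⟨by linarith [hu.1], by linarith [hu'.2]⟩
          ⟨by linarith [ht.1], by linarith [ht'.2]⟩ ⟨by linarith [hδ.1], by linarith [hδ.2]⟩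
          ⟨by norm_num, le_rfl⟩ (by linarith) (by linarith [ht.2, hδ.1]) (by linarith [hδ.2]) (by
            rw [le_div_iff₀ (by linarith [hδ.2])]
            linarith [hδ.1])
        linarith
      have e1 := S.push_Iic ν h.supp ht'
      have e2 := S.push_Iic ν h.supp hu'
      rw [hst] at e1 e2
      rw [e1, e2, ← Finset.sum_sub_distrib]
      calc S.p S.s / 4 * (t - u)
          ≤ S.p S.s * (ν.real (Iic (S.z S.s t)) - ν.real (Iic (S.z S.s u))) := by nlinarith
        _ ≤ ∑ j, S.p j * (ν.real (Iic (S.z j t)) - ν.real (Iic (S.z j u))) :=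
            Finset.single_le_sum (f := fun j => S.p j * (ν.real (Iic (S.z j t)) -
              ν.real (Iic (S.z j u)))) (fun j _ => mul_nonneg (S.p_pos j).le (hr j).1)
              (Finset.mem_univ _)
        _ ≤ _ := Finset.sum_le_sum fun j _ => by
            have := mul_nonneg (S.p_pos j).le (hr j).2
            nlinarith
  have hle : ENNReal.ofReal (S.p S.s / 4) • volume.restrict (Ioc 0 δ) ≤ ν.restrict (Ioc 0 δ) := by
    have : IsFiniteMeasure (ENNReal.ofReal (S.p S.s / 4) • volume.restrict (Ioc 0 δ)) :=
      Measure.smul_finite _ ENNReal.ofReal_ne_top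
    apply measure_le_of_Ioc
    intro c d _
    rw [Measure.smul_apply, Measure.restrict_apply measurableSet_Ioc,
      Measure.restrict_apply measurableSet_Ioc, Ioc_inter_Ioc, Real.volume_Ioc, smul_eq_mul,
      ← ENNReal.ofReal_mul (by positivity)]
    set c' := c ⊔ 0
    set d' := d ⊓ δ
    rcases le_or_gt d' c' with hdc | hdc
    · rw [Ioc_eq_empty (not_lt.2 hdc), ENNReal.ofReal_of_nonpos (by nlinarith)]; simp
    · rw [← ofReal_measureReal (μ := ν)]
      apply ENNReal.ofReal_le_ofReal
      have hc' : 0 ≤ c' := le_sup_right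
      have hd' : d' ≤ δ := inf_le_right
      have hd : Ioc c' d' = Iic d' \ Iic c' := by
        ext y; simp [and_comm]
      rw [hd, measureReal_sdiff (Iic_subset_Iic.2 hdc.le) measurableSet_Iic]
      exact key c' ⟨hc', by linarith⟩ d' ⟨by linarith, hd'⟩ hdc.le
  have := hle E
  rwa [Measure.smul_apply, Measure.restrict_eq_self _ hE, Measure.restrict_eq_self _ hE] at this

end RandomSystem

namespace RandomSystem

variable {N : ℕ} (S : RandomSystem N)

/-- Inverse branches of the `n`-th iterate of the full-branch map `T s`. -/
inductive Branch : ℕ → (ℝ → ℝ) → Prop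
  | zero : Branch 0 id
  | left {n : ℕ} {φ : ℝ → ℝ} : Branch n φ → Branch (n + 1) (S.y S.s ∘ φ)
  | right {n : ℕ} {φ : ℝ → ℝ} : Branch n φ → Branch (n + 1) fun x => (1 + φ x) / 2

variable {S}

theorem half_le_y (j : Fin N) {t : ℝ} (ht : t ∈ Icc (0 : ℝ) 1) : t / 2 ≤ S.y j t := by
  have h := (S.y_concave j).2 (show (0 : ℝ) ∈ Icc (0 : ℝ) 1 by simp)
    (show (1 : ℝ) ∈ Icc (0 : ℝ) 1 by simp) (sub_nonneg.2 ht.2) ht.1 (by ring)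
  simp only [S.y_zero, S.y_one, smul_eq_mul] at h
  have e : (1 - t) * 0 + t * 1 = t := by ring
  rw [e] at h
  linarith

theorem Branch.mem {n : ℕ} {φ : ℝ → ℝ} (h : S.Branch n φ) {t : ℝ} (ht : t ∈ Icc (0 : ℝ) 1) :
    φ t ∈ Icc (0 : ℝ) 1 := by
  induction h with
  | zero => exact ht
  | left _ ih =>
    have := S.y_mem S.s _ ih
    exact ⟨this.1, by simp only [Function.comp]; linarith [this.2]⟩
  | right _ ih => exact ⟨by linarith [ih.1], by linarith [ih.2]⟩

theorem Branch.pos {n : ℕ} {φ : ℝ → ℝ} (h : S.Branch n φ) {t : ℝ} (ht : t ∈ Ioc (0 : ℝ) 1) :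
    0 < φ t := by
  induction h with
  | zero => exact ht.1
  | left h ih =>
    have := half_le_y (S := S) S.s (h.mem (Ioc_subset_Icc_self ht))
    simp only [Function.comp]
    linarith
  | right _ ih => linarith

theorem Branch.mono {n : ℕ} {φ : ℝ → ℝ} (h : S.Branch n φ) : MonotoneOn φ (Icc 0 1) := by
  induction h with
  | zero => exact monotoneOn_id
  | left h ih =>
    intro u hu t ht hut
    exact S.y_mono S.s (h.mem hu) (h.mem ht) (ih hu ht hut)
  | right _ ih =>
    intro u hu t ht hut
    have := ih hu ht hut
    simp only
    linarith

theorem Branch.concave {n : ℕ} {φ : ℝ → ℝ} (h : S.Branch n φ) : ConcaveOn ℝ (Icc 0 1) φ := by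
  induction h with
  | zero => exact concaveOn_id (convex_Icc _ _)
  | left h ih =>
    refine ⟨convex_Icc _ _, fun u hu t ht a b ha hb hab => ?_⟩
    have h1 := (S.y_concave S.s).2 (h.mem hu) (h.mem ht) ha hb hab
    have h2 := ih.2 hu ht ha hb hab
    exact h1.trans (S.y_mono S.s ((convex_Icc (0 : ℝ) 1) (h.mem hu) (h.mem ht) ha hb hab)
      (h.mem ((convex_Icc (0 : ℝ) 1) hu ht ha hb hab)) h2)
  | right _ ih =>
    refine ⟨convex_Icc _ _, fun u hu t ht a b ha hb hab => ?_⟩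
    have h2 := ih.2 hu ht ha hb hab
    simp only [smul_eq_mul] at h2 ⊢
    linarith

theorem Branch.sub_le {n : ℕ} {φ : ℝ → ℝ} (h : S.Branch n φ) {u t : ℝ} (hu : u ∈ Icc (0 : ℝ) 1)
    (ht : t ∈ Icc (0 : ℝ) 1) (hut : u ≤ t) : φ t - φ u ≤ t - u := by
  induction h with
  | zero => exact le_rfl
  | left h ih => exact (S.y_sub_le S.s (h.mem hu) (h.mem ht) (h.mono hu ht hut)).trans ih
  | right h ih =>
    have := h.mono hu ht hut
    linarith

theorem Branch.iterate {n : ℕ} {φ : ℝ → ℝ} (h : S.Branch n φ) {t : ℝ} (ht : t ∈ Ioc (0 : ℝ) 1) :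
    (S.T S.s)^[n] (φ t) = t := by
  induction h with
  | zero => rfl
  | left h ih =>
    rw [Function.iterate_succ_apply, Function.comp,
      S.T_y S.s _ ⟨h.pos ht, (h.mem (Ioc_subset_Icc_self ht)).2⟩, ih]
  | right h ih =>
    rw [Function.iterate_succ_apply,
      S.T_z S.s S.s_notMem _ ⟨h.pos ht, (h.mem (Ioc_subset_Icc_self ht)).2⟩, ih]

theorem continuousOn_of_sub_le {f : ℝ → ℝ} (hm : MonotoneOn f (Icc 0 1))
    (h : ∀ u ∈ Icc (0 : ℝ) 1, ∀ t ∈ Icc (0 : ℝ) 1, u ≤ t → f t - f u ≤ t - u) :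
    ContinuousOn f (Icc 0 1) := by
  have : LipschitzOnWith 1 f (Icc 0 1) := by
    refine LipschitzOnWith.of_dist_le_mul fun u hu t ht => ?_
    rw [NNReal.coe_one, one_mul, Real.dist_eq, Real.dist_eq]
    rcases le_total u t with hut | hut
    · rw [abs_sub_comm, abs_sub_comm u, abs_of_nonneg (sub_nonneg.2 hut),
        abs_of_nonneg (sub_nonneg.2 (hm hu ht hut))]
      exact h u hu t ht hut
    · rw [abs_of_nonneg (sub_nonneg.2 hut), abs_of_nonneg (sub_nonneg.2 (hm ht hu hut))]
      exact h t ht u hu hut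
  exact this.continuousOn

theorem Branch.continuousOn {n : ℕ} {φ : ℝ → ℝ} (h : S.Branch n φ) :
    ContinuousOn φ (Icc 0 1) :=
  continuousOn_of_sub_le h.mono fun _ hu _ ht => h.sub_le hu ht

theorem Branch.zero_lt_one {n : ℕ} {φ : ℝ → ℝ} (h : S.Branch n φ) : φ 0 < φ 1 := by
  have h0 : φ 0 ≤ φ (1 / 2) := h.mono (by simp) (by norm_num) (by norm_num)
  have h1 : φ (1 / 2) ≤ φ 1 := h.mono (by norm_num) (by simp) (by norm_num)
  refine (h0.trans h1).lt_of_ne fun he => ?_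
  have h2 : φ (1 / 2) = φ 1 := le_antisymm h1 (he ▸ h0)
  have h3 := h.iterate (t := 1) (by simp)
  rw [← h2, h.iterate (by norm_num)] at h3
  norm_num at h3

theorem Branch.length_add_le {n : ℕ} {φ : ℝ → ℝ} (h : S.Branch n φ) {ℓ : ℝ} (hℓ : 0 < ℓ)
    (hφ : ℓ ≤ φ 1 - φ 0) : φ 1 - φ 0 + n * (ℓ * ℓ ^ S.e S.s) ≤ 1 := by
  induction h with
  | zero => simp
  | @left n φ h ih =>
    have h1 := S.y_expand S.s (φ 0) (h.mem (by simp)) (φ 1) (h.mem (by simp)) h.zero_lt_one.le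
    have h2 := (S.y_mem S.s (φ 0) (h.mem (by simp))).1
    simp only [Function.comp] at hφ ⊢
    have h3 : ℓ ^ S.e S.s ≤ S.y S.s (φ 1) ^ S.e S.s :=
      Real.rpow_le_rpow hℓ.le (by linarith) (S.e_pos _).le
    have h4 : 0 < ℓ ^ S.e S.s := Real.rpow_pos_of_pos hℓ _
    have h5 : ℓ * ℓ ^ S.e S.s ≤ (S.y S.s (φ 1) - S.y S.s (φ 0)) * S.y S.s (φ 1) ^ S.e S.s :=
      mul_le_mul hφ h3 h4.le (by linarith)
    have h6 := ih (by nlinarith)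
    push_cast
    nlinarith
  | @right n φ h ih =>
    have h1 := (h.mem (t := 1) (by simp)).2
    have h2 := (h.mem (t := 0) (by simp)).1
    have h3 : ℓ ^ S.e S.s ≤ 1 := Real.rpow_le_one hℓ.le (by linarith) (S.e_pos _).le
    have h6 := ih (by linarith)
    push_cast
    nlinarith

theorem exists_branch_length_lt (S : RandomSystem N) {ℓ : ℝ} (hℓ : 0 < ℓ) :
    ∃ n, ∀ φ, S.Branch n φ → φ 1 - φ 0 < ℓ := by
  have hc : 0 < ℓ * ℓ ^ S.e S.s := mul_pos hℓ (Real.rpow_pos_of_pos hℓ _)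
  obtain ⟨n, hn⟩ := exists_nat_gt (1 / (ℓ * ℓ ^ S.e S.s))
  refine ⟨n, fun φ hφ => ?_⟩
  by_contra! hcon
  have h1 := hφ.length_add_le hℓ hcon
  rw [div_lt_iff₀ hc] at hn
  linarith [hφ.zero_lt_one]

theorem exists_branch_pair (S : RandomSystem N) (n : ℕ) : ∀ g : ℝ → ℝ,
    (∀ φ, S.Branch n φ → g (φ 0) ≤ g (φ 1)) → ∀ u t : ℝ, 0 ≤ u → u ≤ t → t ≤ 1 →
    ∃ φ ψ, S.Branch n φ ∧ S.Branch n ψ ∧ φ 0 ≤ u ∧ u ≤ φ 1 ∧ ψ 0 ≤ t ∧ t ≤ ψ 1 ∧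
      (φ = ψ ∨ g (φ 1) ≤ g (ψ 0)) := by
  induction n with
  | zero =>
    intro g _ u t hu hut ht
    exact ⟨id, id, .zero, .zero, hu, hut.trans ht, hu.trans hut, ht, Or.inl rfl⟩
  | succ n ih =>
    intro g hg u t hu hut ht
    have hcont : ContinuousOn (S.y S.s) (Icc 0 1) :=
      continuousOn_of_sub_le (S.y_mono S.s) fun _ hu _ ht => S.y_sub_le S.s hu ht
    have surj : ∀ x, 0 ≤ x → x ≤ 1 / 2 → ∃ v ∈ Icc (0 : ℝ) 1, S.y S.s v = x := by
      intro x hx hx'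
      have := intermediate_value_Icc zero_le_one hcont
      rw [S.y_zero, S.y_one] at this
      exact this ⟨hx, hx'⟩
    have ihl := ih (g ∘ S.y S.s) fun φ hφ => hg _ hφ.left
    have ihr := ih (g ∘ fun x => (1 + x) / 2) fun φ hφ => hg _ hφ.right
    have m0 : (0 : ℝ) ∈ Icc (0 : ℝ) 1 := by simp
    have m1 : (1 : ℝ) ∈ Icc (0 : ℝ) 1 := by simp
    rcases le_total t (1 / 2) with ht2 | ht2
    · obtain ⟨u', hu', rfl⟩ := surj u hu (hut.trans ht2)
      obtain ⟨t', ht', rfl⟩ := surj t (hu.trans hut) ht2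
      have hut' : u' ≤ t' ∨ S.y S.s u' = S.y S.s t' := by
        rcases le_total u' t' with h | h
        · exact Or.inl h
        · exact Or.inr (le_antisymm hut (S.y_mono S.s ht' hu' h))
      rcases hut' with hut' | heq
      · obtain ⟨φ, ψ, hφ, hψ, h1, h2, h3, h4, h5⟩ := ihl u' t' hu'.1 hut' ht'.2
        refine ⟨_, _, hφ.left, hψ.left, S.y_mono S.s (hφ.mem m0) hu' h1,
          S.y_mono S.s hu' (hφ.mem m1) h2, S.y_mono S.s (hψ.mem m0) ht' h3,
          S.y_mono S.s ht' (hψ.mem m1) h4, ?_⟩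
        exact h5.imp (fun h => by rw [h]) id
      · obtain ⟨φ, ψ, hφ, hψ, h1, h2, -⟩ := ihl u' u' hu'.1 le_rfl hu'.2
        refine ⟨_, _, hφ.left, hφ.left, S.y_mono S.s (hφ.mem m0) hu' h1,
          S.y_mono S.s hu' (hφ.mem m1) h2, ?_, ?_, Or.inl rfl⟩
        · rw [← heq]; exact S.y_mono S.s (hφ.mem m0) hu' h1
        · rw [← heq]; exact S.y_mono S.s hu' (hφ.mem m1) h2
    rcases le_total u (1 / 2) with hu2 | hu2
    · obtain ⟨u', hu', rfl⟩ := surj u hu hu2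
      obtain ⟨φ, φ', hφ, hφ', h1, h2, h3, h4, h5⟩ := ihl u' 1 hu'.1 hu'.2 le_rfl
      obtain ⟨ψ', ψ, hψ', hψ, k1, k2, k3, k4, k5⟩ :=
        ihr 0 (2 * t - 1) le_rfl (by linarith) (by linarith)
      refine ⟨_, _, hφ.left, hψ.right, S.y_mono S.s (hφ.mem m0) hu' h1,
        S.y_mono S.s hu' (hφ.mem m1) h2, by linarith, by linarith,
        Or.inr ?_⟩
      have e1 : φ' 1 = 1 := le_antisymm (hφ'.mem m1).2 h4
      have e2 : ψ' 0 = 0 := le_antisymm k1 (hψ'.mem m0).1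
      have a1 : g (S.y S.s (φ 1)) ≤ g (1 / 2) := by
        rcases h5 with h5 | h5
        · rw [h5, e1, S.y_one]
        · refine h5.trans ?_
          have := hg _ hφ'.left
          simpa only [Function.comp, e1, S.y_one] using this
      have a2 : g (1 / 2) ≤ g ((1 + ψ 0) / 2) := by
        rcases k5 with k5 | k5
        · rw [← k5, e2, add_zero]
        · refine le_trans ?_ k5
          have := hg _ hψ'.right
          simpa only [Function.comp, e2, add_zero] using this
      exact a1.trans a2
    · obtain ⟨φ, ψ, hφ, hψ, h1, h2, h3, h4, h5⟩ :=
        ihr (2 * u - 1) (2 * t - 1) (by linarith) (by linarith) (by linarith)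
      refine ⟨_, _, hφ.right, hψ.right, by linarith, by linarith,
        by linarith, by linarith, ?_⟩
      exact h5.imp (fun h => by rw [h]) id

theorem le_of_branch_le (S : RandomSystem N) {g : ℝ → ℝ}
    (hg : ∀ n φ, S.Branch n φ → g (φ 0) ≤ g (φ 1))
    (hlip : ∀ u t : ℝ, 0 ≤ u → u ≤ t → t ≤ 1 → |g t - g u| ≤ t - u)
    {u t : ℝ} (hu : 0 ≤ u) (hut : u ≤ t) (ht : t ≤ 1) : g u ≤ g t := by
  refine le_of_forall_pos_le_add fun ε hε => ?_
  obtain ⟨n, hn⟩ := S.exists_branch_length_lt (half_pos hε)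
  obtain ⟨φ, ψ, hφ, hψ, h1, h2, h3, h4, h5⟩ := S.exists_branch_pair n g (hg n) u t hu hut ht
  have m0 : (0 : ℝ) ∈ Icc (0 : ℝ) 1 := by simp
  have m1 : (1 : ℝ) ∈ Icc (0 : ℝ) 1 := by simp
  rcases h5 with rfl | h5
  · have := (abs_le.1 (hlip u t hu hut ht)).1
    linarith [hn φ hφ]
  · have a1 := (abs_le.1 (hlip u (φ 1) hu h2 (hφ.mem m1).2)).1
    have a2 := (abs_le.1 (hlip (ψ 0) t (hψ.mem m0).1 h3 ht)).1
    linarith [hn φ hφ, hn ψ hψ]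

end RandomSystem

namespace RandomSystem

variable {N : ℕ} {S : RandomSystem N}

theorem exists_branch_diff_lt (S : RandomSystem N) {B : Set ℝ} (hB : MeasurableSet B)
    (hpos : volume (B ∩ Ioc 0 1) ≠ 0) {ε : ℝ} (hε : 0 < ε) (hε1 : ε ≤ 1) :
    ∃ n φ, S.Branch n φ ∧ volume.real (Ioc (φ 0) (φ 1) \ B) < ε * (φ 1 - φ 0) := by
  by_contra! hcon
  have m0 : (0 : ℝ) ∈ Icc (0 : ℝ) 1 := by simp
  have m1 : (1 : ℝ) ∈ Icc (0 : ℝ) 1 := by simp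
  have fin : ∀ u t : ℝ, volume (Ioc u t \ B) ≠ ⊤ := fun u t =>
    ((measure_mono sdiff_subset).trans_lt measure_Ioc_lt_top).ne
  have incr : ∀ u t : ℝ, 0 ≤ u → u ≤ t →
      volume.real (Ioc 0 t \ B) = volume.real (Ioc 0 u \ B) + volume.real (Ioc u t \ B) := by
    intro u t hu hut
    rw [← measureReal_union _ (measurableSet_Ioc.diff hB) (fin _ _) (fin _ _), ← union_sdiff_distrib,
      Ioc_union_Ioc_eq_Ioc hu hut]
    rw [Set.disjoint_left]
    intro x hx hx'
    exact absurd hx.1.2 (not_le.2 hx'.1.1)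
  have up : ∀ u t : ℝ, u ≤ t → volume.real (Ioc u t \ B) ≤ t - u := by
    intro u t hut
    refine (measureReal_mono sdiff_subset measure_Ioc_lt_top.ne).trans ?_
    rw [Measure.real, Real.volume_Ioc, ENNReal.toReal_ofReal (sub_nonneg.2 hut)]
  have key := fun u t (hu : (0 : ℝ) ≤ u) hut ht =>
    S.le_of_branch_le (g := fun t => volume.real (Ioc 0 t \ B) - ε * t) (u := u) (t := t) ?_ ?_
    hu hut ht
  · have hle : ENNReal.ofReal ε • volume.restrict (Ioc (0 : ℝ) 1) ≤
        volume.restrict (Ioc (0 : ℝ) 1 \ B) := by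
      have : IsFiniteMeasure (ENNReal.ofReal ε • volume.restrict (Ioc (0 : ℝ) 1)) :=
        Measure.smul_finite _ ENNReal.ofReal_ne_top
      have : IsFiniteMeasure (volume.restrict (Ioc (0 : ℝ) 1 \ B)) :=
        ⟨by rw [Measure.restrict_apply_univ]; exact (fin _ _).lt_top⟩
      refine measure_le_of_Ioc fun x y _ => ?_
      rw [Measure.smul_apply, Measure.restrict_apply measurableSet_Ioc,
        Measure.restrict_apply measurableSet_Ioc, smul_eq_mul, ← inter_sdiff_assoc, Ioc_inter_Ioc]
      set u := x ⊔ 0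
      set t := y ⊓ 1
      rcases le_or_gt t u with h | h
      · rw [Ioc_eq_empty (not_lt.2 h)]
        simp
      · have k := key u t le_sup_right h.le inf_le_right
        rw [incr u t le_sup_right h.le] at k
        rw [Real.volume_Ioc, ← ENNReal.ofReal_mul hε.le]
        refine ENNReal.ofReal_le_of_le_toReal ?_
        change _ ≤ volume.real _
        linarith
    have h := hle (B ∩ Ioc 0 1)
    have hz : volume.restrict (Ioc (0 : ℝ) 1 \ B) (B ∩ Ioc 0 1) = 0 := by
      rw [Measure.restrict_apply (hB.inter measurableSet_Ioc)]
      convert measure_empty (μ := (volume : Measure ℝ))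
      ext x
      simp only [mem_inter_iff, Set.mem_sdiff, mem_empty_iff_false]
      tauto
    rw [hz, Measure.smul_apply, Measure.restrict_apply (hB.inter measurableSet_Ioc), inter_assoc,
      inter_self, smul_eq_mul, nonpos_iff_eq_zero, mul_eq_zero, ENNReal.ofReal_eq_zero] at h
    exact h.elim (fun h => absurd hε (not_lt.2 h)) hpos
  · intro n φ hφ
    have h1 := hcon n φ hφ
    have h2 := incr (φ 0) (φ 1) (hφ.mem m0).1 hφ.zero_lt_one.le
    linarith
  · intro u t hu hut ht
    have h1 := up u t hut
    have h2 := incr u t hu hut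
    have h3 : 0 ≤ volume.real (Ioc u t \ B) := measureReal_nonneg
    rw [h2, abs_le]
    constructor <;> nlinarith

/-- The law of `T s ^ n` under normalised Lebesgue measure on the cylinder of a branch. -/
noncomputable def branchMeasure (S : RandomSystem N) (n : ℕ) (φ : ℝ → ℝ) : Measure ℝ :=
  ENNReal.ofReal (1 / (φ 1 - φ 0)) • (volume.restrict (Ioc (φ 0) (φ 1))).map (S.T S.s)^[n]

theorem branchMeasure_apply (n : ℕ) (φ : ℝ → ℝ) {E : Set ℝ} (hE : MeasurableSet E) :
    S.branchMeasure n φ E =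
      ENNReal.ofReal (1 / (φ 1 - φ 0)) * volume ((S.T S.s)^[n] ⁻¹' E ∩ Ioc (φ 0) (φ 1)) := by
  have hm : Measurable (S.T S.s)^[n] := (S.meas S.s).iterate n
  rw [branchMeasure, Measure.smul_apply, Measure.map_apply hm hE,
    Measure.restrict_apply (hm hE), smul_eq_mul]

theorem Branch.preim {n : ℕ} {φ : ℝ → ℝ} (h : S.Branch n φ) {t : ℝ} (ht : t ∈ Icc (0 : ℝ) 1) :
    (S.T S.s)^[n] ⁻¹' Iic t ∩ Ioc (φ 0) (φ 1) = Ioc (φ 0) (φ t) := by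
  have m0 : (0 : ℝ) ∈ Icc (0 : ℝ) 1 := by simp
  have m1 : (1 : ℝ) ∈ Icc (0 : ℝ) 1 := by simp
  have key : ∀ x ∈ Ioc (φ 0) (φ 1), ((S.T S.s)^[n] x ≤ t ↔ x ≤ φ t) := by
    intro x hx
    obtain ⟨u, hu, rfl⟩ := intermediate_value_Icc zero_le_one h.continuousOn ⟨hx.1.le, hx.2⟩
    have hu0 : 0 < u := by
      refine hu.1.lt_of_ne ?_
      rintro rfl
      exact lt_irrefl _ hx.1
    rw [h.iterate ⟨hu0, hu.2⟩]
    refine ⟨fun hut => h.mono hu ht hut, fun hle => ?_⟩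
    by_contra! hlt
    have he : φ u = φ t := le_antisymm hle (h.mono ht hu hlt.le)
    rcases ht.1.eq_or_lt with rfl | ht0
    · exact absurd hx.1 (not_lt.2 hle)
    · have := h.iterate ⟨hu0, hu.2⟩
      rw [he, h.iterate ⟨ht0, ht.2⟩] at this
      exact hlt.ne this
  ext x
  constructor
  · rintro ⟨hx1, hx2⟩
    exact ⟨hx2.1, (key x hx2).1 hx1⟩
  · intro hx
    have hx2 : x ∈ Ioc (φ 0) (φ 1) := ⟨hx.1, hx.2.trans (h.mono ht m1 ht.2)⟩
    exact ⟨(key x hx2).2 hx.2, hx2⟩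

theorem maps_to_iterate (j : Fin N) (n : ℕ) : MapsTo (S.T j)^[n] (Ioc 0 1) (Ioc 0 1) :=
  MapsTo.iterate (S.maps_to j) n

theorem Branch.good {n : ℕ} {φ : ℝ → ℝ} (h : S.Branch n φ) :
    S.Good (1 / (φ 1 - φ 0)) (1 / (φ 1 - φ 0)) (S.branchMeasure n φ) := by
  have m0 : (0 : ℝ) ∈ Icc (0 : ℝ) 1 := by simp
  have m1 : (1 : ℝ) ∈ Icc (0 : ℝ) 1 := by simp
  have hℓ : 0 < φ 1 - φ 0 := sub_pos.2 h.zero_lt_one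
  have hinv : 0 < 1 / (φ 1 - φ 0) := one_div_pos.2 hℓ
  have hG : ∀ t ∈ Icc (0 : ℝ) 1, (S.branchMeasure n φ).real (Iic t) =
      1 / (φ 1 - φ 0) * (φ t - φ 0) := by
    intro t ht
    rw [Measure.real, branchMeasure_apply n φ measurableSet_Iic, h.preim ht, Real.volume_Ioc,
      ← ENNReal.ofReal_mul hinv.le, ENNReal.toReal_ofReal]
    exact mul_nonneg hinv.le (sub_nonneg.2 (h.mono m0 ht ht.1))
  have hconc : ConcaveOn ℝ (Icc 0 1) fun t => (S.branchMeasure n φ).real (Iic t) := by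
    have : ConcaveOn ℝ (Icc 0 1) fun t => 1 / (φ 1 - φ 0) * (φ t - φ 0) := by
      have := (h.concave.add_const (-φ 0)).smul hinv.le
      simpa only [smul_eq_mul, sub_eq_add_neg, Pi.add_apply] using this
    exact this.congr fun t ht => (hG t ht).symm
  refine ⟨⟨?_⟩, ?_, hconc.subset (Icc_subset_Icc_right (by norm_num)) (convex_Icc _ _),
    hconc.subset (Icc_subset_Icc_left (by norm_num)) (convex_Icc _ _), ?_, ?_⟩
  · rw [branchMeasure_apply n φ MeasurableSet.univ, preimage_univ, univ_inter, Real.volume_Ioc,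
      ← ENNReal.ofReal_mul hinv.le, one_div_mul_cancel hℓ.ne', ENNReal.ofReal_one]
  · rw [branchMeasure_apply n φ measurableSet_Ioc.compl]
    convert mul_zero _
    convert measure_empty (μ := (volume : Measure ℝ))
    rw [eq_empty_iff_forall_notMem]
    rintro x ⟨hx1, hx2⟩
    exact hx1 (maps_to_iterate (S := S) S.s n ⟨(h.mem m0).1.trans_lt hx2.1, hx2.2.trans (h.mem m1).2⟩)
  · intro t ht
    have ht1 : t ∈ Icc (0 : ℝ) 1 := ⟨ht.1, by linarith [ht.2]⟩
    have hh : (1 / 2 : ℝ) ∈ Icc (0 : ℝ) 1 := by norm_num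
    have ht2 : 1 / 2 + t ∈ Icc (0 : ℝ) 1 := ⟨by linarith [ht.1], by linarith [ht.2]⟩
    rw [hG _ ht2, hG _ hh, ← mul_sub]
    have h1 := h.sub_le hh ht2 (by linarith [ht.1])
    have h2 := le_rpow_γ (S := S) ht1
    exact mul_le_mul_of_nonneg_left (by linarith) hinv.le
  · intro t ht
    have ht1 : t ∈ Icc (0 : ℝ) 1 := ⟨ht.1, by linarith [ht.2]⟩
    rw [hG _ ht1]
    have h1 := h.sub_le m0 ht1 ht.1
    have h2 : t ≤ t ^ (S.γ - S.a) := Real.self_le_rpow_of_le_one ht1.1 ht1.2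
      (by linarith [S.γ_lt, S.a_pos])
    exact mul_le_mul_of_nonneg_left (by linarith) hinv.le

/-- Constants for which `Good` is preserved by `push` and contains a given pair. -/
theorem exists_constants (S : RandomSystem N) (C : ℝ) : ∃ A B : ℝ, C ≤ A ∧ C ≤ B ∧
    6 ≤ A * (1 - S.eta) ∧ 0 ≤ A ∧ 2 * A ≤ B * (S.p S.jmin * (S.γ - S.a)) ∧ 0 ≤ B := by
  refine ⟨max C S.A₀, max C (2 * max C S.A₀ / (S.p S.jmin * (S.γ - S.a))), le_max_left _ _,
    le_max_left _ _, ?_, S.A₀_pos.le.trans (le_max_right _ _), ?_, ?_⟩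
  · rw [← div_le_iff₀ S.one_sub_eta_pos]
    exact le_max_right _ _
  · rw [← div_le_iff₀ S.pδ_pos]
    exact le_max_right _ _
  · refine le_trans (div_nonneg ?_ S.pδ_pos.le) (le_max_right _ _)
    linarith [S.A₀_pos, le_max_right C S.A₀]

theorem exists_stationary_of_branch {n : ℕ} {φ : ℝ → ℝ} (h : S.Branch n φ) :
    ∃ A B : ℝ, 0 ≤ A ∧ (∀ k, S.Good A B (S.push^[k] (S.branchMeasure n φ))) ∧
      ∃ ν : Measure ℝ, S.Good A B ν ∧ S.push ν = ν ∧ ∀ E, MeasurableSet E → ∀ ε,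
        (∀ k, (S.push^[k] (S.branchMeasure n φ)).real E ≤ ε) → ν.real E ≤ ε := by
  obtain ⟨A, B, h1, h2, h3, h4, h5, h6⟩ := S.exists_constants (1 / (φ 1 - φ 0))
  have hg := h.good.mono h1 h2
  refine ⟨A, B, h4, fun k => ?_, S.exists_stationary hg h3 h4 h5 h6⟩
  induction k with
  | zero => exact hg
  | succ k ih =>
    rw [Function.iterate_succ_apply']
    exact ih.push h3 h4 h5 h6

theorem exists_good_stationary (S : RandomSystem N) :
    ∃ ν : Measure ℝ, IsProbabilityMeasure ν ∧ ν ≪ volume.restrict (Icc (0 : ℝ) 1) ∧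
      S.push ν = ν := by
  obtain ⟨A, B, -, -, ν, hν, hst, -⟩ := exists_stationary_of_branch (S := S) Branch.zero
  exact ⟨ν, hν.prob, hν.absolutelyContinuous, hst⟩

theorem branchMeasure_zero (S : RandomSystem N) :
    S.branchMeasure 0 id = volume.restrict (Ioc (0 : ℝ) 1) := by
  simp [branchMeasure]

/-- Nonsingularity of the maps with respect to Lebesgue measure. -/
theorem volume_preimage_eq_zero (j : Fin N) {E : Set ℝ} (hE : volume E = 0) :
    volume (Ioc 0 1 ∩ S.T j ⁻¹' E) = 0 := by
  obtain ⟨A, B, -, hg, -⟩ := exists_stationary_of_branch (S := S) Branch.zero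
  have h1 := (hg 1).absolutelyContinuous
  rw [Function.iterate_one, branchMeasure_zero] at h1
  have h2 : S.push (volume.restrict (Ioc (0 : ℝ) 1)) (toMeasurable volume E) = 0 := by
    refine h1 (le_antisymm ((Measure.restrict_apply_le _ _).trans ?_) bot_le)
    rw [measure_toMeasurable, hE]
  rw [S.push_apply _ (measurableSet_toMeasurable _ _), Finset.sum_eq_zero_iff] at h2
  have h3 := (mul_eq_zero.1 (h2 j (Finset.mem_univ _))).resolve_left
    (by simpa using S.p_pos j)
  rw [Measure.restrict_apply (S.meas j (measurableSet_toMeasurable _ _))] at h3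
  refine measure_mono_null ?_ h3
  rintro x ⟨hx1, hx2⟩
  exact ⟨subset_toMeasurable _ _ hx2, hx1⟩

/-- Invariant sets of positive Lebesgue measure contain almost all of a neighbourhood of `0`. -/
theorem exists_full_of_invariant (S : RandomSystem N) : ∃ δ : ℝ, 0 < δ ∧
    ∀ B : Set ℝ, MeasurableSet B → volume (B ∩ Ioc 0 1) ≠ 0 →
      (∀ j, volume (B ∩ Ioc 0 1 ∩ S.T j ⁻¹' Bᶜ) = 0) → volume (Ioc 0 δ \ B) = 0 := by
  obtain ⟨c, δ, hc, hδ, hδ2, hlow⟩ := S.exists_lower_bound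
  refine ⟨δ, hδ, fun B hB hpos hinv => ?_⟩
  have key : ∀ ε : ℝ, 0 < ε → ε ≤ 1 → c * volume.real (Ioc 0 δ \ B) ≤ ε := by
    intro ε hε hε1
    obtain ⟨n, φ, hφ, hlt⟩ := S.exists_branch_diff_lt hB hpos hε hε1
    obtain ⟨A, C, hA, hgood, ν, hν, hst, hlim⟩ := exists_stationary_of_branch hφ
    have m0 : (0 : ℝ) ∈ Icc (0 : ℝ) 1 := by simp
    have m1 : (1 : ℝ) ∈ Icc (0 : ℝ) 1 := by simp
    have hℓ : 0 < φ 1 - φ 0 := sub_pos.2 hφ.zero_lt_one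
    have hiter : ∀ m, volume (B ∩ Ioc 0 1 ∩ (S.T S.s)^[m] ⁻¹' Bᶜ) = 0 := by
      intro m
      induction m with
      | zero =>
        convert measure_empty (μ := (volume : Measure ℝ))
        rw [eq_empty_iff_forall_notMem]
        rintro x ⟨hx1, hx2⟩
        exact hx2 hx1.1
      | succ m ih =>
        refine measure_mono_null (t := B ∩ Ioc 0 1 ∩ S.T S.s ⁻¹' Bᶜ ∪
          (Ioc 0 1 ∩ S.T S.s ⁻¹' (B ∩ Ioc 0 1 ∩ (S.T S.s)^[m] ⁻¹' Bᶜ))) ?_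
          (measure_union_null (hinv _) (volume_preimage_eq_zero _ ih))
        rintro x ⟨hx1, hx2⟩
        by_cases hx : S.T S.s x ∈ B
        · exact Or.inr ⟨hx1.2, ⟨hx, S.maps_to _ x hx1.2⟩, hx2⟩
        · exact Or.inl ⟨hx1, hx⟩
    have h0 : (S.branchMeasure n φ).real Bᶜ ≤ ε := by
      have hsub : volume ((S.T S.s)^[n] ⁻¹' Bᶜ ∩ Ioc (φ 0) (φ 1)) ≤
          volume (Ioc (φ 0) (φ 1) \ B) := by
        refine (measure_mono (t := (Ioc (φ 0) (φ 1) \ B) ∪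
          (B ∩ Ioc 0 1 ∩ (S.T S.s)^[n] ⁻¹' Bᶜ)) ?_).trans
          ((measure_union_le _ _).trans (by rw [hiter n, add_zero]))
        rintro x ⟨hx1, hx2⟩
        by_cases hx : x ∈ B
        · exact Or.inr ⟨⟨hx, (hφ.mem m0).1.trans_lt hx2.1, hx2.2.trans (hφ.mem m1).2⟩, hx1⟩
        · exact Or.inl ⟨hx2, hx⟩
      rw [Measure.real, branchMeasure_apply n φ hB.compl, ENNReal.toReal_mul,
        ENNReal.toReal_ofReal (one_div_pos.2 hℓ).le, one_div, inv_mul_le_iff₀ hℓ]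
      refine (ENNReal.toReal_mono ?_ hsub).trans (by rw [mul_comm]; exact hlt.le)
      exact ((measure_mono sdiff_subset).trans_lt measure_Ioc_lt_top).ne
    have hk : ∀ k, (S.push^[k] (S.branchMeasure n φ)).real Bᶜ ≤ ε := by
      intro k
      induction k with
      | zero => exact h0
      | succ k ih =>
        rw [Function.iterate_succ_apply']
        refine le_trans ?_ ih
        have hgk := hgood k
        set ρ := S.push^[k] (S.branchMeasure n φ)
        have := hgk.prob
        rw [S.push_real ρ hB.compl]
        have hj : ∀ j, ρ.real (S.T j ⁻¹' Bᶜ) ≤ ρ.real Bᶜ := by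
          intro j
          have hz : ρ ((B ∩ Ioc 0 1 ∩ S.T j ⁻¹' Bᶜ) ∪ (Ioc 0 1)ᶜ) = 0 := by
            refine measure_union_null (hgk.absolutelyContinuous ?_) hgk.supp
            exact le_antisymm ((Measure.restrict_apply_le _ _).trans (hinv j).le) bot_le
          refine ENNReal.toReal_mono (measure_ne_top _ _) ?_
          refine (measure_mono (t := Bᶜ ∪ ((B ∩ Ioc 0 1 ∩ S.T j ⁻¹' Bᶜ) ∪ (Ioc 0 1)ᶜ)) ?_).trans
            ((measure_union_le _ _).trans (by rw [hz, add_zero]))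
          intro x hx
          by_cases hxB : x ∈ B
          · by_cases hx1 : x ∈ Ioc (0 : ℝ) 1
            · exact Or.inr (Or.inl ⟨⟨hxB, hx1⟩, hx⟩)
            · exact Or.inr (Or.inr hx1)
          · exact Or.inl hxB
        calc _ ≤ ∑ j, S.p j * ρ.real Bᶜ :=
              Finset.sum_le_sum fun j _ => mul_le_mul_of_nonneg_left (hj j) (S.p_pos j).le
          _ = ρ.real Bᶜ := by rw [← Finset.sum_mul, S.p_sum, one_mul]
    have h1 := hlim Bᶜ hB.compl ε hk
    have h2 := hlow A C ν hA hν hst (Ioc 0 δ \ B) sdiff_subset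
    have := hν.prob
    have h3 := ENNReal.toReal_mono (measure_ne_top _ _) h2
    rw [ENNReal.toReal_mul, ENNReal.toReal_ofReal hc.le] at h3
    exact h3.trans ((measureReal_mono (μ := ν) fun x hx => hx.2).trans h1)
  have hz : c * volume.real (Ioc 0 δ \ B) ≤ 0 := by
    refine le_of_forall_pos_le_add fun ε hε => ?_
    rw [zero_add]
    exact (key (min ε 1) (lt_min hε one_pos) (min_le_right _ _)).trans (min_le_left _ _)
  have hz2 : volume.real (Ioc 0 δ \ B) = 0 :=
    le_antisymm (by nlinarith) measureReal_nonneg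
  exact (measureReal_eq_zero_iff
    ((measure_mono sdiff_subset).trans_lt measure_Ioc_lt_top).ne).1 hz2

end RandomSystem

namespace RandomSystem

variable {N : ℕ} {S : RandomSystem N}

theorem stationary_not_mutuallySingular {ν₁ ν₂ : Measure ℝ} [IsFiniteMeasure ν₁]
    [IsFiniteMeasure ν₂] (h₁ : ν₁ ≪ volume.restrict (Icc (0 : ℝ) 1))
    (h₂ : ν₂ ≪ volume.restrict (Icc (0 : ℝ) 1)) (hs₁ : S.push ν₁ = ν₁) (hs₂ : S.push ν₂ = ν₂)
    (hn₁ : ν₁ ≠ 0) (hn₂ : ν₂ ≠ 0) : ¬ ν₁ ⟂ₘ ν₂ := by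
  obtain ⟨δ, hδ, hfull⟩ := S.exists_full_of_invariant
  set m := volume.restrict (Icc (0 : ℝ) 1) with hm
  have supp : ∀ ν : Measure ℝ, IsFiniteMeasure ν → ν ≪ m → S.push ν = ν → ν ≠ 0 →
      ∃ B : Set ℝ, (∀ s, ν s = 0 → m (B ∩ s) = 0) ∧ volume (Ioc 0 δ \ B) = 0 := by
    intro ν _ hac hst hne
    have hmeas : Measurable (ν.rnDeriv m) := Measure.measurable_rnDeriv _ _
    set B := {x | ν.rnDeriv m x ≠ 0} with hB
    have hBm : MeasurableSet B := hmeas (measurableSet_singleton 0).compl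
    have hnull : ∀ s, ν s = 0 → m (B ∩ s) = 0 := by
      intro s hs
      rw [← Measure.withDensity_rnDeriv_eq ν m hac] at hs
      exact (withDensity_apply_eq_zero' hmeas.aemeasurable).1 hs
    have hBc : ν Bᶜ = 0 := by
      rw [← Measure.withDensity_rnDeriv_eq ν m hac, withDensity_apply_eq_zero' hmeas.aemeasurable,
        inter_compl_self, measure_empty]
    have to_m : ∀ s, MeasurableSet s → m s = 0 → volume (s ∩ Ioc 0 1) = 0 := by
      intro s hs h0
      rw [hm, Measure.restrict_apply hs] at h0
      exact measure_mono_null (inter_subset_inter_right _ Ioc_subset_Icc_self) h0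
    refine ⟨B, hnull, hfull B hBm (fun h0 => hne ?_) fun j => ?_⟩
    · have h1 : m B = 0 := by
        rw [hm, Measure.restrict_apply hBm]
        refine measure_mono_null (t := B ∩ Ioc 0 1 ∪ {0}) ?_
          (measure_union_null h0 Real.volume_singleton)
        rintro x ⟨hx, hx1⟩
        rcases hx1.1.eq_or_lt with h | h
        · exact Or.inr h.symm
        · exact Or.inl ⟨hx, h, hx1.2⟩
      rw [← Measure.measure_univ_eq_zero, ← union_compl_self B]
      exact measure_union_null (hac h1) hBc
    · have h1 : S.push ν Bᶜ = 0 := by rw [hst, hBc]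
      rw [S.push_apply _ hBm.compl, Finset.sum_eq_zero_iff] at h1
      have h2 := (mul_eq_zero.1 (h1 j (Finset.mem_univ _))).resolve_left
        (by simpa using S.p_pos j)
      have h3 := to_m _ (hBm.inter (S.meas j hBm.compl)) (hnull _ h2)
      rwa [inter_right_comm]
  obtain ⟨B₁, hz₁, hf₁⟩ := supp ν₁ inferInstance h₁ hs₁ hn₁
  obtain ⟨B₂, hz₂, hf₂⟩ := supp ν₂ inferInstance h₂ hs₂ hn₂
  rintro ⟨s, hs, hs1, hs2⟩
  have h3 : m (B₁ ∩ B₂) = 0 := by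
    refine measure_mono_null (t := B₁ ∩ s ∪ B₂ ∩ sᶜ) ?_
      (measure_union_null (hz₁ _ hs1) (hz₂ _ hs2))
    rintro x ⟨hx1, hx2⟩
    by_cases hx : x ∈ s
    · exact Or.inl ⟨hx1, hx⟩
    · exact Or.inr ⟨hx2, hx⟩
  have h4 : volume (B₁ ∩ B₂ ∩ Icc 0 1) = 0 := by
    rwa [hm, Measure.restrict_apply' measurableSet_Icc] at h3
  have h5 : volume (Ioc 0 (min δ 1)) = 0 := by
    refine measure_mono_null (t := (B₁ ∩ B₂ ∩ Icc 0 1) ∪ (Ioc 0 δ \ B₁ ∪ Ioc 0 δ \ B₂)) ?_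
      (measure_union_null h4 (measure_union_null hf₁ hf₂))
    rintro x ⟨hx0, hx⟩
    have hxδ : x ∈ Ioc 0 δ := ⟨hx0, hx.trans (min_le_left _ _)⟩
    by_cases hx1 : x ∈ B₁
    · by_cases hx2 : x ∈ B₂
      · exact Or.inl ⟨⟨hx1, hx2⟩, hx0.le, hx.trans (min_le_right _ _)⟩
      · exact Or.inr (Or.inr ⟨hxδ, hx2⟩)
    · exact Or.inr (Or.inl ⟨hxδ, hx1⟩)
  rw [Real.volume_Ioc, ENNReal.ofReal_eq_zero] at h5
  linarith [lt_min hδ one_pos]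

theorem stationary_unique {μ₁ μ₂ : Measure ℝ} [IsProbabilityMeasure μ₁]
    [IsProbabilityMeasure μ₂] (h₁ : μ₁ ≪ volume.restrict (Icc (0 : ℝ) 1))
    (h₂ : μ₂ ≪ volume.restrict (Icc (0 : ℝ) 1)) (hs₁ : S.push μ₁ = μ₁) (hs₂ : S.push μ₂ = μ₂) :
    μ₁ = μ₂ := by
  set ρ := μ₁ ⊓ μ₂
  have hρ₁ : ρ ≤ μ₁ := inf_le_left
  have hρ₂ : ρ ≤ μ₂ := inf_le_right
  have : IsFiniteMeasure ρ := isFiniteMeasure_of_le μ₁ hρ₁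
  have hρ : S.push ρ = ρ := by
    refine Measure.eq_of_le_of_measure_univ_eq (le_inf ?_ ?_) (S.push_univ ρ)
    · exact (S.push_mono hρ₁).trans hs₁.le
    · exact (S.push_mono hρ₂).trans hs₂.le
  have stat : ∀ μ : Measure ℝ, IsFiniteMeasure μ → ρ ≤ μ → S.push μ = μ →
      S.push (μ - ρ) = μ - ρ := by
    intro μ _ hle hst
    have e := Measure.sub_add_cancel_of_le hle
    rw [← e, push_add, hρ, add_comm _ ρ, add_comm _ ρ, Measure.add_right_inj] at hst
    exact hst
  have hsing : (μ₁ - ρ) ⟂ₘ (μ₂ - ρ) := by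
    rw [Measure.mutuallySingular_iff_disjoint, disjoint_iff_inf_le]
    set κ := (μ₁ - ρ) ⊓ (μ₂ - ρ)
    have k1 : κ + ρ ≤ μ₁ := by
      conv_rhs => rw [← Measure.sub_add_cancel_of_le hρ₁]
      exact add_le_add_left inf_le_left ρ
    have k2 : κ + ρ ≤ μ₂ := by
      conv_rhs => rw [← Measure.sub_add_cancel_of_le hρ₂]
      exact add_le_add_left inf_le_right ρ
    have k3 : κ + ρ ≤ ρ := le_inf k1 k2
    have k4 : κ univ + ρ univ ≤ 0 + ρ univ := by
      rw [zero_add]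
      exact k3 univ
    have k5 : κ univ ≤ 0 := (ENNReal.add_le_add_iff_right (measure_ne_top ρ univ)).1 k4
    exact (Measure.measure_univ_eq_zero.1 (le_antisymm k5 bot_le)).le
  have final : ∀ μ μ' : Measure ℝ, IsProbabilityMeasure μ → IsProbabilityMeasure μ' → ρ ≤ μ →
      ρ ≤ μ' → μ - ρ = 0 → μ = μ' := by
    intro μ μ' _ _ hle hle' h0
    have e := Measure.sub_add_cancel_of_le hle
    rw [h0, zero_add] at e
    refine Measure.eq_of_le_of_measure_univ_eq (e ▸ hle') ?_
    rw [measure_univ, measure_univ]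
  by_contra hne
  refine stationary_not_mutuallySingular (S := S) (Measure.sub_le.absolutelyContinuous.trans h₁)
    (Measure.sub_le.absolutelyContinuous.trans h₂) (stat _ inferInstance hρ₁ hs₁)
    (stat _ inferInstance hρ₂ hs₂) (fun h => hne ?_) (fun h => hne ?_) hsing
  · exact final μ₁ μ₂ inferInstance inferInstance hρ₁ hρ₂ h
  · exact (final μ₂ μ₁ inferInstance inferInstance hρ₂ hρ₁ h).symm

end RandomSystem

/-- Prepend a symbol to a one-sided sequence. -/
def consSeq {N : ℕ} (j : Fin N) (ω : ℕ → Fin N) : ℕ → Fin N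
  | 0 => j
  | k + 1 => ω k

/-- The cylinder of sequences starting with the word `u`. -/
def cyl {N n : ℕ} (u : Fin n → Fin N) : Set (ℕ → Fin N) := {ω | ∀ i : Fin n, ω (i : ℕ) = u i}

theorem measurable_consSeq {N : ℕ} (j : Fin N) : Measurable (consSeq j) := by
  refine measurable_pi_iff.2 fun k => ?_
  cases k with
  | zero => exact measurable_const
  | succ k => exact measurable_pi_apply k

theorem measurableSet_cyl {N n : ℕ} (u : Fin n → Fin N) : MeasurableSet (cyl u) := by
  have : cyl u = ⋂ i : Fin n, (fun ω : ℕ → Fin N => ω (i : ℕ)) ⁻¹' {u i} := by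
    ext ω
    simp [cyl]
  rw [this]
  exact MeasurableSet.iInter fun i => measurable_pi_apply _ (measurableSet_singleton _)

theorem cyl_zero {N : ℕ} (u : Fin 0 → Fin N) : cyl u = univ :=
  eq_univ_of_forall fun _ i => i.elim0

theorem preimage_consSeq_cyl {N n : ℕ} (j : Fin N) (u : Fin (n + 1) → Fin N) :
    consSeq j ⁻¹' cyl u = {ω | j = u 0 ∧ ω ∈ cyl fun i => u i.succ} := by
  ext ω
  simp only [cyl, mem_preimage, mem_ofPred_eq, Fin.forall_fin_succ]
  rfl

theorem ext_of_cyl {N : ℕ} {μ ν : Measure (ℕ → Fin N)} [IsFiniteMeasure μ]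
    (h : ∀ (n : ℕ) (u : Fin n → Fin N), μ (cyl u) = ν (cyl u)) : μ = ν := by
  refine ext_of_generate_finite {s | ∃ (n : ℕ) (u : Fin n → Fin N), s = cyl u} ?_ ?_ ?_ ?_
  · refine le_antisymm (iSup_le fun k => ?_) (MeasurableSpace.generateFrom_le ?_)
    · rintro _ ⟨s, -, rfl⟩
      have : (fun ω : ℕ → Fin N => ω k) ⁻¹' s =
          ⋃ u : {u : Fin (k + 1) → Fin N // u (Fin.last k) ∈ s}, cyl u.1 := by
        ext ω
        simp only [mem_preimage, mem_iUnion]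
        constructor
        · exact fun hω => ⟨⟨fun i => ω i, by simpa using hω⟩, fun i => rfl⟩
        · rintro ⟨⟨u, hu⟩, hω⟩
          have := hω (Fin.last k)
          rw [Fin.val_last] at this
          rwa [this]
      rw [this]
      exact MeasurableSet.iUnion fun u =>
        MeasurableSpace.measurableSet_generateFrom ⟨_, u.1, rfl⟩
    · rintro _ ⟨n, u, rfl⟩
      exact measurableSet_cyl u
  · rintro _ ⟨n, u, rfl⟩ _ ⟨m, v, rfl⟩ ⟨x, hxu, hxv⟩
    refine ⟨max n m, fun i => x i, ?_⟩
    ext ω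
    constructor
    · rintro ⟨h1, h2⟩ i
      rcases lt_max_iff.1 i.2 with hi | hi
      · exact (h1 ⟨i, hi⟩).trans (hxu ⟨i, hi⟩).symm
      · exact (h2 ⟨i, hi⟩).trans (hxv ⟨i, hi⟩).symm
    · intro hω
      exact ⟨fun i => (hω ⟨i, i.2.trans_le (le_max_left _ _)⟩).trans (hxu i),
        fun i => (hω ⟨i, i.2.trans_le (le_max_right _ _)⟩).trans (hxv i)⟩
  · rintro _ ⟨n, u, rfl⟩
    exact h n u
  · have := h 0 Fin.elim0
    rwa [cyl_zero] at this

namespace RandomSystem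

variable {N : ℕ} {S : RandomSystem N}

theorem measurable_skewProd : Measurable (skewProd S.T) := by
  refine Measurable.prodMk ?_ ?_
  · exact measurable_pi_iff.2 fun k => (measurable_pi_apply (k + 1)).comp measurable_fst
  · have h0 : Measurable fun q : (ℕ → Fin N) × ℝ => q.1 0 :=
      (measurable_pi_apply 0).comp measurable_fst
    intro E hE
    have : (fun q : (ℕ → Fin N) × ℝ => S.T (q.1 0) q.2) ⁻¹' E =
        ⋃ j, (fun q : (ℕ → Fin N) × ℝ => q.1 0) ⁻¹' {j} ∩ (fun q => q.2) ⁻¹' (S.T j ⁻¹' E) := by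
      ext q
      simp
    rw [this]
    exact MeasurableSet.iUnion fun j => (h0 (measurableSet_singleton j)).inter
      (measurable_snd (S.meas j hE))

theorem bernoulli_apply {P : Measure (ℕ → Fin N)} [IsProbabilityMeasure P]
    (hP : ∀ (n : ℕ) (u : Fin n → Fin N), P (cyl u) = ∏ i, ENNReal.ofReal (S.p (u i)))
    {E : Set (ℕ → Fin N)} (hE : MeasurableSet E) :
    P E = ∑ j, ENNReal.ofReal (S.p j) * P (consSeq j ⁻¹' E) := by
  have key : P = ∑ j, ENNReal.ofReal (S.p j) • P.map (consSeq j) := by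
    refine ext_of_cyl fun n u => ?_
    simp only [Measure.coe_finsetSum, Finset.sum_apply, Measure.smul_apply, smul_eq_mul]
    cases n with
    | zero =>
      rw [cyl_zero, measure_univ]
      have : ∀ j, P.map (consSeq j) univ = 1 := fun j => by
        rw [Measure.map_apply (measurable_consSeq j) MeasurableSet.univ, preimage_univ,
          measure_univ]
      simp only [this, mul_one, S.p_sum_ofReal]
    | succ n =>
      rw [Finset.sum_eq_single (u 0), Measure.map_apply (measurable_consSeq _)
        (measurableSet_cyl u), preimage_consSeq_cyl, hP, Fin.prod_univ_succ]
      · congr 1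
        have := hP n fun i => u i.succ
        rw [← this]
        simp
      · intro j _ hj
        rw [Measure.map_apply (measurable_consSeq _) (measurableSet_cyl u), preimage_consSeq_cyl]
        simp [hj]
      · exact fun h => absurd (Finset.mem_univ _) h
  conv_lhs => rw [key]
  simp only [Measure.coe_finsetSum, Finset.sum_apply, Measure.smul_apply, smul_eq_mul]
  exact Finset.sum_congr rfl fun j _ => by rw [Measure.map_apply (measurable_consSeq j) hE]

theorem lintegral_push (ν : Measure ℝ) {f : ℝ → ENNReal} (hf : Measurable f) :
    ∫⁻ x, f x ∂(S.push ν) = ∑ j, ENNReal.ofReal (S.p j) * ∫⁻ x, f (S.T j x) ∂ν := by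
  rw [push, lintegral_finsetSum_measure]
  exact Finset.sum_congr rfl fun j _ => by
    rw [lintegral_smul_measure, lintegral_map hf (S.meas j), smul_eq_mul]

theorem slice_preimage {P : Measure (ℕ → Fin N)} [IsProbabilityMeasure P]
    (hP : ∀ (n : ℕ) (u : Fin n → Fin N), P (cyl u) = ∏ i, ENNReal.ofReal (S.p (u i)))
    {A : Set ((ℕ → Fin N) × ℝ)} (hA : MeasurableSet A) (x : ℝ) :
    P ((fun ω => (ω, x)) ⁻¹' (skewProd S.T ⁻¹' A)) =
      ∑ j, ENNReal.ofReal (S.p j) * P ((fun ω => (ω, S.T j x)) ⁻¹' A) :=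
  bernoulli_apply hP (measurable_prodMk_right (measurable_skewProd hA))

theorem measurePreserving_skewProd {P : Measure (ℕ → Fin N)} [IsProbabilityMeasure P]
    (hP : ∀ (n : ℕ) (u : Fin n → Fin N), P (cyl u) = ∏ i, ENNReal.ofReal (S.p (u i)))
    {μ : Measure ℝ} [IsProbabilityMeasure μ] (hst : S.push μ = μ) :
    MeasurePreserving (skewProd S.T) (P.prod μ) (P.prod μ) := by
  refine ⟨measurable_skewProd, ?_⟩
  ext A hA
  rw [Measure.map_apply measurable_skewProd hA, Measure.prod_apply_symm hA,
    Measure.prod_apply_symm (measurable_skewProd hA)]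
  simp only [slice_preimage hP hA]
  have hm : Measurable fun x => P ((fun ω => (ω, x)) ⁻¹' A) := measurable_measure_prodMk_right hA
  have hmT : ∀ j, Measurable fun x => P ((fun ω => (ω, S.T j x)) ⁻¹' A) := fun j =>
    hm.comp (S.meas j)
  rw [lintegral_finsetSum _ fun j _ => (hmT j).const_mul _]
  conv_rhs => rw [← hst, lintegral_push μ hm]
  exact Finset.sum_congr rfl fun j _ => lintegral_const_mul _ (hmT j)

theorem absolutelyContinuous_map {μ : Measure ℝ} (hst : S.push μ = μ) (j : Fin N) :
    μ.map (S.T j) ≪ μ := by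
  refine Measure.AbsolutelyContinuous.mk fun E hE h0 => ?_
  rw [← hst, S.push_apply _ hE, Finset.sum_eq_zero_iff] at h0
  rw [Measure.map_apply (S.meas j) hE]
  exact (mul_eq_zero.1 (h0 j (Finset.mem_univ _))).resolve_left (by simpa using S.p_pos j)

/-- Bounded harmonic functions are invariant almost everywhere. -/
theorem harmonic_invariant {μ : Measure ℝ} [IsProbabilityMeasure μ] (hst : S.push μ = μ)
    {g : ℝ → ℝ} (hg : Measurable g) (h0 : ∀ x, 0 ≤ g x) (h1 : ∀ x, g x ≤ 1)
    (hharm : ∀ x, g x = ∑ j, S.p j * g (S.T j x)) (j : Fin N) :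
    ∀ᵐ x ∂μ, g (S.T j x) = g x := by
  have bdd : ∀ {f : ℝ → ℝ}, Measurable f → (∀ x, 0 ≤ f x) → (∀ x, f x ≤ 1) → Integrable f μ := by
    intro f hf hf0 hf1
    refine Integrable.of_bound hf.aestronglyMeasurable 1 (ae_of_all _ fun x => ?_)
    rw [Real.norm_eq_abs, abs_of_nonneg (hf0 x)]
    exact hf1 x
  have sq : ∀ {f : ℝ → ℝ}, Measurable f → (∀ x, 0 ≤ f x) → (∀ x, f x ≤ 1) →
      Integrable (fun x => f x ^ 2) μ := fun hf hf0 hf1 =>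
    bdd (hf.pow_const 2) (fun x => sq_nonneg _) fun x => pow_le_one₀ (hf0 x) (hf1 x)
  have hgT : ∀ i, Measurable fun x => g (S.T i x) := fun i => hg.comp (S.meas i)
  have hsq : ∀ i, Integrable (fun x => g (S.T i x) ^ 2) μ := fun i =>
    sq (hgT i) (fun _ => h0 _) fun _ => h1 _
  have hid : ∀ x, ∑ i, S.p i * (g (S.T i x) - g x) ^ 2 =
      ∑ i, S.p i * g (S.T i x) ^ 2 - g x ^ 2 := by
    intro x
    have e1 : ∀ i, S.p i * (g (S.T i x) - g x) ^ 2 = S.p i * g (S.T i x) ^ 2 -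
        2 * g x * (S.p i * g (S.T i x)) + g x ^ 2 * S.p i := fun i => by ring
    simp only [e1, Finset.sum_add_distrib, Finset.sum_sub_distrib, ← Finset.mul_sum, S.p_sum,
      ← hharm]
    ring
  have hint : ∑ i, S.p i * ∫ x, g (S.T i x) ^ 2 ∂μ = ∫ x, g x ^ 2 ∂μ := by
    have hl : ∀ f : ℝ → ℝ, Measurable f → ∫ x, f x ^ 2 ∂μ =
        (∫⁻ x, ENNReal.ofReal (f x ^ 2) ∂μ).toReal := fun f hf =>
      integral_eq_lintegral_of_nonneg_ae (ae_of_all _ fun x => sq_nonneg _)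
        (hf.pow_const 2).aestronglyMeasurable
    rw [hl g hg]
    conv_rhs => rw [← hst, lintegral_push (f := fun x => ENNReal.ofReal (g x ^ 2)) μ
      (hg.pow_const 2).ennreal_ofReal]
    rw [ENNReal.toReal_sum]
    · refine Finset.sum_congr rfl fun i _ => ?_
      rw [ENNReal.toReal_mul, ENNReal.toReal_ofReal (S.p_pos i).le, hl _ (hgT i)]
    · intro i _
      refine ENNReal.mul_ne_top ENNReal.ofReal_ne_top ?_
      exact (hsq i).lintegral_lt_top.ne
  have hzero : ∫ x, ∑ i, S.p i * (g (S.T i x) - g x) ^ 2 ∂μ = 0 := by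
    simp only [hid]
    rw [integral_sub (integrable_finsetSum _ fun i _ => (hsq i).const_mul _) (sq hg h0 h1),
      integral_finsetSum _ fun i _ => (hsq i).const_mul _]
    simp only [integral_const_mul]
    rw [hint, sub_self]
  have hnn : ∀ x, ∀ i ∈ Finset.univ, 0 ≤ S.p i * (g (S.T i x) - g x) ^ 2 := fun x i _ =>
    mul_nonneg (S.p_pos i).le (sq_nonneg _)
  rw [integral_eq_zero_iff_of_nonneg (fun x => Finset.sum_nonneg (hnn x))] at hzero
  · filter_upwards [hzero] with x hx
    have := (Finset.sum_eq_zero_iff_of_nonneg (hnn x)).1 hx j (Finset.mem_univ _)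
    have := (mul_eq_zero.1 this).resolve_left (S.p_pos j).ne'
    exact sub_eq_zero.1 (pow_eq_zero_iff two_ne_zero |>.1 this)
  · simp only [hid]
    exact (integrable_finsetSum _ fun i _ => (hsq i).const_mul _).sub (sq hg h0 h1)

/-- Invariant densities are constant. -/
theorem ae_eq_const_of_invariant {μ : Measure ℝ} [IsProbabilityMeasure μ]
    (hac : μ ≪ volume.restrict (Icc (0 : ℝ) 1)) (hst : S.push μ = μ) {h : ℝ → ENNReal}
    (hm : Measurable h) (h1 : ∀ x, h x ≤ 1) (hinv : ∀ j, ∀ᵐ x ∂μ, h (S.T j x) = h x) :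
    ∀ᵐ x ∂μ, h x = ∫⁻ y, h y ∂μ := by
  set c := ∫⁻ y, h y ∂μ with hc
  have hc1 : c ≤ 1 := (lintegral_mono h1).trans (by simp)
  have hctop : c ≠ ⊤ := (hc1.trans_lt ENNReal.one_lt_top).ne
  set ρ := μ.withDensity h with hρ
  have hρu : ρ univ = c := by rw [hρ, withDensity_apply _ MeasurableSet.univ, Measure.restrict_univ]
  have hρst : S.push ρ = ρ := by
    ext E hE
    have e : ∀ E, MeasurableSet E → ρ E = ∫⁻ x, E.indicator h x ∂μ := fun E hE => by
      rw [hρ, withDensity_apply _ hE, lintegral_indicator hE]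
    rw [S.push_apply _ hE, e E hE]
    conv_rhs => rw [← hst, lintegral_push μ (hm.indicator hE)]
    refine Finset.sum_congr rfl fun j _ => ?_
    rw [e _ (S.meas j hE)]
    congr 1
    refine lintegral_congr_ae ?_
    filter_upwards [hinv j] with x hx
    by_cases hx' : S.T j x ∈ E
    · rw [indicator_of_mem (show x ∈ S.T j ⁻¹' E from hx'), indicator_of_mem hx', hx]
    · rw [indicator_of_notMem (show x ∉ S.T j ⁻¹' E from hx'), indicator_of_notMem hx']
  have hρc : ρ = c • μ := by
    rcases eq_or_ne c 0 with h0 | h0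
    · rw [h0, zero_smul, ← Measure.measure_univ_eq_zero, hρu, h0]
    · have : IsProbabilityMeasure (c⁻¹ • ρ) := ⟨by
        rw [Measure.smul_apply, hρu, smul_eq_mul, ENNReal.inv_mul_cancel h0 hctop]⟩
      have hst' : S.push (c⁻¹ • ρ) = c⁻¹ • ρ := by
        ext E hE
        rw [S.push_apply _ hE]
        conv_rhs => rw [← hρst]
        rw [Measure.smul_apply, S.push_apply _ hE, smul_eq_mul, Finset.mul_sum]
        exact Finset.sum_congr rfl fun j _ => by rw [Measure.smul_apply, smul_eq_mul]; ring
      have hac' : c⁻¹ • ρ ≪ volume.restrict (Icc (0 : ℝ) 1) :=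
        (Measure.AbsolutelyContinuous.smul_left
          ((withDensity_absolutelyContinuous μ h).trans hac) _)
      have := stationary_unique hac' hac hst' hst
      rw [← this, smul_smul, ENNReal.mul_inv_cancel h0 hctop, one_smul]
  have : μ.withDensity h = μ.withDensity fun _ => c := by rw [withDensity_const, ← hρc]
  exact (withDensity_eq_iff_of_sigmaFinite hm.aemeasurable aemeasurable_const).1 this

theorem ergodic_skewProd {P : Measure (ℕ → Fin N)} [IsProbabilityMeasure P]
    (hP : ∀ (n : ℕ) (u : Fin n → Fin N), P (cyl u) = ∏ i, ENNReal.ofReal (S.p (u i)))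
    {μ : Measure ℝ} [IsProbabilityMeasure μ] (hac : μ ≪ volume.restrict (Icc (0 : ℝ) 1))
    (hst : S.push μ = μ) : Ergodic (skewProd S.T) (P.prod μ) := by
  refine { toMeasurePreserving := measurePreserving_skewProd hP hst, toPreErgodic := ⟨?_⟩ }
  intro A hA hAinv
  set h : ℝ → ENNReal := fun x => P ((fun ω => (ω, x)) ⁻¹' A) with hh
  have hm : Measurable h := measurable_measure_prodMk_right hA
  have h1 : ∀ x, h x ≤ 1 := fun x => prob_le_one
  have hAx : ∀ x, MeasurableSet ((fun ω : ℕ → Fin N => (ω, x)) ⁻¹' A) := fun x =>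
    measurable_prodMk_right hA
  have hcons : ∀ j x, consSeq j ⁻¹' ((fun ω : ℕ → Fin N => (ω, x)) ⁻¹' A) =
      (fun ω => (ω, S.T j x)) ⁻¹' A := by
    intro j x
    conv_lhs => rw [← hAinv]
    rfl
  have hharm : ∀ x, h x = ∑ j, ENNReal.ofReal (S.p j) * h (S.T j x) := by
    intro x
    rw [hh]
    simp only
    rw [bernoulli_apply hP (hAx x)]
    simp only [hcons]
  have hinv : ∀ j, ∀ᵐ x ∂μ, h (S.T j x) = h x := by
    intro j
    have := harmonic_invariant hst (g := fun x => (h x).toReal) hm.ennreal_toReal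
      (fun x => ENNReal.toReal_nonneg)
      (fun x => by simpa using ENNReal.toReal_mono ENNReal.one_ne_top (h1 x)) ?_ j
    · filter_upwards [this] with x hx
      exact (ENNReal.toReal_eq_toReal_iff' (measure_ne_top _ _) (measure_ne_top _ _)).1 hx
    · intro x
      conv_lhs => rw [hharm x]
      rw [ENNReal.toReal_sum fun j _ =>
        ENNReal.mul_ne_top ENNReal.ofReal_ne_top (measure_ne_top _ _)]
      exact Finset.sum_congr rfl fun j _ => by
        rw [ENNReal.toReal_mul, ENNReal.toReal_ofReal (S.p_pos j).le]
  set c := ∫⁻ y, h y ∂μ with hc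
  have hconst := ae_eq_const_of_invariant hac hst hm h1 hinv
  have hcyl : ∀ (n : ℕ) (u : Fin n → Fin N),
      ∀ᵐ x ∂μ, P (((fun ω => (ω, x)) ⁻¹' A) ∩ cyl u) = c * P (cyl u) := by
    intro n
    induction n with
    | zero =>
      intro u
      filter_upwards [hconst] with x hx
      rw [cyl_zero, inter_univ, measure_univ, mul_one]
      exact hx
    | succ n ih =>
      intro u
      have := ae_of_ae_map (S.meas (u 0)).aemeasurable
        ((absolutelyContinuous_map hst (u 0)).ae_le (ih fun i => u i.succ))
      filter_upwards [this] with x hx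
      rw [bernoulli_apply hP ((hAx x).inter (measurableSet_cyl u)),
        Finset.sum_eq_single (u 0), preimage_inter, hcons, preimage_consSeq_cyl, hP,
        Fin.prod_univ_succ, ← hP n fun i => u i.succ]
      · simp only [true_and, ofPred_mem_eq]
        rw [hx]
        ring
      · intro j _ hj
        rw [preimage_inter, preimage_consSeq_cyl]
        simp [hj]
      · exact fun h => absurd (Finset.mem_univ _) h
  have hall : ∀ᵐ x ∂μ, ∀ (n : ℕ) (u : Fin n → Fin N),
      P (((fun ω => (ω, x)) ⁻¹' A) ∩ cyl u) = c * P (cyl u) :=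
    ae_all_iff.2 fun n => ae_all_iff.2 fun u => hcyl n u
  have hcc : c = c * c := by
    obtain ⟨x, hx, hxc⟩ := (hall.and hconst).exists
    have e : P.restrict ((fun ω => (ω, x)) ⁻¹' A) = c • P := by
      refine ext_of_cyl fun n u => ?_
      rw [Measure.restrict_apply (measurableSet_cyl u), inter_comm, hx n u, Measure.smul_apply,
        smul_eq_mul]
    have e2 := congrArg (fun m : Measure (ℕ → Fin N) => m ((fun ω => (ω, x)) ⁻¹' A)) e
    simp only [Measure.smul_apply, smul_eq_mul, Measure.restrict_apply_self] at e2
    have hxc' : P ((fun ω => (ω, x)) ⁻¹' A) = c := hxc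
    rwa [hxc'] at e2
  have hPA : (P.prod μ) A = c := Measure.prod_apply_symm hA
  rw [Filter.eventuallyConst_set']
  rcases eq_or_ne c 0 with h0 | h0
  · left
    exact ae_eq_empty.2 (hPA.trans h0)
  · right
    have hctop : c ≠ ⊤ := hPA ▸ measure_ne_top _ _
    have hc1 : c = 1 := by
      have : c * 1 = c * c := by rw [mul_one]; exact hcc
      exact ((ENNReal.mul_right_inj h0 hctop).1 this).symm
    rw [ae_eq_univ, prob_compl_eq_zero_iff hA, hPA, hc1]

end RandomSystem

theorem lsvLeft_eq {α x : ℝ} (hx : 0 ≤ x) : lsvLeft α x = x * (1 + (2 * x) ^ α) := by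
  rw [lsvLeft, Real.mul_rpow two_pos.le hx]

theorem lsvLeft_expand {α a b : ℝ} (hα : 0 < α) (ha : 0 ≤ a) (hab : a ≤ b) :
    (b - a) * (1 + b ^ α) ≤ lsvLeft α b - lsvLeft α a := by
  have hb := ha.trans hab
  rw [lsvLeft_eq ha, lsvLeft_eq hb]
  have h1 : (2 * a) ^ α ≤ (2 * b) ^ α := Real.rpow_le_rpow (by linarith) (by linarith) hα.le
  have h2 : b ^ α ≤ (2 * b) ^ α := Real.rpow_le_rpow hb (by linarith) hα.le
  have h3 := mul_le_mul_of_nonneg_left h1 ha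
  have h4 := mul_le_mul_of_nonneg_left h2 (sub_nonneg.2 hab)
  linarith

theorem lsvLeft_strictMonoOn {α : ℝ} (hα : 0 < α) : StrictMonoOn (lsvLeft α) (Ici 0) := by
  intro a ha b _ hab
  have h1 := lsvLeft_expand hα ha hab.le
  have h2 : 0 ≤ b ^ α := Real.rpow_nonneg (le_trans ha hab.le) _
  nlinarith

theorem lsvLeft_zero (α : ℝ) : lsvLeft α 0 = 0 := by rw [lsvLeft, zero_mul]

theorem lsvLeft_half (α : ℝ) : lsvLeft α (1 / 2) = 1 := by
  rw [lsvLeft_eq (by norm_num)]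
  norm_num

theorem continuous_lsvLeft {α : ℝ} (hα : 0 < α) : Continuous (lsvLeft α) :=
  continuous_id.mul (continuous_const.add
    (continuous_const.mul (continuous_id.rpow_const fun _ => Or.inr hα.le)))

theorem convexOn_lsvLeft {α : ℝ} (hα : 0 < α) : ConvexOn ℝ (Ici 0) (lsvLeft α) := by
  have h1 : ConvexOn ℝ (Ici 0) fun x : ℝ => x + (2 : ℝ) ^ α • x ^ (1 + α) :=
    (convexOn_id (convex_Ici 0)).add
      ((convexOn_rpow (by linarith)).smul (Real.rpow_nonneg two_pos.le α))
  refine h1.congr fun x hx => ?_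
  simp only [smul_eq_mul]
  rw [lsvLeft, Real.rpow_add' hx (by linarith), Real.rpow_one]
  ring

theorem exists_inverse_lsvLeft {α : ℝ} (hα : 0 < α) : ∃ y : ℝ → ℝ,
    (∀ t ∈ Icc (0 : ℝ) 1, y t ∈ Icc (0 : ℝ) (1 / 2)) ∧
    (∀ t ∈ Icc (0 : ℝ) 1, lsvLeft α (y t) = t) ∧
    (∀ t ∈ Icc (0 : ℝ) 1, ∀ x ∈ Icc (0 : ℝ) (1 / 2), lsvLeft α x ≤ t ↔ x ≤ y t) ∧
    MonotoneOn y (Icc 0 1) ∧ ConcaveOn ℝ (Icc 0 1) y ∧ y 0 = 0 ∧ y 1 = 1 / 2 ∧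
    1 / 4 ≤ y (1 / 2) ∧
    (∀ u ∈ Icc (0 : ℝ) 1, ∀ t ∈ Icc (0 : ℝ) 1, u ≤ t →
      (y t - y u) * (1 + y t ^ α) ≤ t - u) ∧
    ∀ t ∈ Icc (0 : ℝ) 1, y t ≤ t * (1 - t ^ α / 2) := by
  have hsub : Icc (0 : ℝ) (1 / 2) ⊆ Ici 0 := fun x hx => hx.1
  obtain ⟨y, h1, h2, h3, h4⟩ := exists_concave_inverse (show (0 : ℝ) < 1 / 2 by norm_num)
    ((convexOn_lsvLeft hα).subset hsub (convex_Icc _ _)) (continuous_lsvLeft hα).continuousOn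
    ((lsvLeft_strictMonoOn hα).mono hsub) (lsvLeft_zero α) (lsvLeft_half α)
  have m0 : (0 : ℝ) ∈ Icc (0 : ℝ) 1 := by simp
  have m1 : (1 : ℝ) ∈ Icc (0 : ℝ) 1 := by simp
  refine ⟨y, fun t ht => (h1 t ht).1, fun t ht => (h1 t ht).2, h2, h3, h4, ?_, ?_, ?_, ?_, ?_⟩
  · refine (lsvLeft_strictMonoOn hα).injOn (h1 0 m0).1.1 self_mem_Ici ?_
    rw [(h1 0 m0).2, lsvLeft_zero]
  · refine (lsvLeft_strictMonoOn hα).injOn (h1 1 m1).1.1 (by norm_num) ?_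
    rw [(h1 1 m1).2, lsvLeft_half]
  · refine (h2 (1 / 2) (by norm_num) (1 / 4) (by norm_num)).1 ?_
    rw [lsvLeft_eq (by norm_num)]
    have : (2 * (1 / 4) : ℝ) ^ α ≤ 1 := Real.rpow_le_one (by norm_num) (by norm_num) hα.le
    linarith
  · intro u hu t ht hut
    have := lsvLeft_expand hα (h1 u hu).1.1 (h3 hu ht hut)
    rwa [(h1 u hu).2, (h1 t ht).2] at this
  · intro t ht
    obtain ⟨⟨k0, k1⟩, k2⟩ := h1 t ht
    rw [lsvLeft_eq k0] at k2
    have k3 : (2 * y t) ^ α ≤ 1 := Real.rpow_le_one (by linarith) (by linarith) hα.le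
    have k4 : t ≤ 2 * y t := by nlinarith
    have k5 : t ^ α ≤ (2 * y t) ^ α := Real.rpow_le_rpow ht.1 k4 hα.le
    have k6 := mul_le_mul k4 k5 (Real.rpow_nonneg ht.1 α) (by linarith)
    linarith

/-- The right branch of `R_{α,K}`. -/
noncomputable def rRight (K x : ℝ) : ℝ := 1 / 2 + K * (x - 1 / 2) + 2 * (1 - K) * (x - 1 / 2) ^ 2

theorem rRight_strictMonoOn {K : ℝ} (hK : K ∈ Ioo (0 : ℝ) 1) :
    StrictMonoOn (rRight K) (Ici (1 / 2)) := by
  intro a ha b _ hab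
  have ha' : 0 ≤ a - 1 / 2 := sub_nonneg.2 ha
  have h1 : 0 < K * (b - a) := mul_pos hK.1 (sub_pos.2 hab)
  have h2 : 0 ≤ (1 - K) * ((b - a) * ((b - 1 / 2) + (a - 1 / 2))) :=
    mul_nonneg (by linarith [hK.2]) (mul_nonneg (by linarith) (by linarith))
  simp only [rRight]
  nlinarith

theorem convexOn_rRight {K : ℝ} (hK : K ∈ Ioo (0 : ℝ) 1) (s : Set ℝ) (hs : Convex ℝ s) :
    ConvexOn ℝ s (rRight K) := by
  refine ⟨hs, fun u _ t _ a b ha hb hab => ?_⟩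
  obtain rfl : b = 1 - a := by linarith
  simp only [rRight, smul_eq_mul]
  have : 0 ≤ (1 - K) * (a * (1 - a) * (u - t) ^ 2) :=
    mul_nonneg (by linarith [hK.2]) (mul_nonneg (mul_nonneg ha hb) (sq_nonneg _))
  nlinarith

theorem exists_inverse_rRight {K : ℝ} (hK : K ∈ Ioo (0 : ℝ) 1) : ∃ z : ℝ → ℝ,
    (∀ t ∈ Icc (0 : ℝ) 1, z t ∈ Icc (1 / 2 : ℝ) 1) ∧
    (∀ t ∈ Icc (0 : ℝ) 1, ∀ x ∈ Ioc (1 / 2 : ℝ) 1, rRight K x ≤ t ↔ x ≤ z t) ∧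
    MonotoneOn z (Icc 0 1) ∧ ConcaveOn ℝ (Icc 0 (1 / 2)) z ∧ ConcaveOn ℝ (Icc (1 / 2) 1) z ∧
    (∀ t ∈ Icc (0 : ℝ) (1 / 2), z t = 1 / 2) ∧
    ∀ t ∈ Icc (0 : ℝ) (1 / 2), z (1 / 2 + t) - 1 / 2 ≤ t / K := by
  have hsub : Icc (1 / 2 : ℝ) 1 ⊆ Ici (1 / 2) := fun x hx => hx.1
  have hhalf : rRight K (1 / 2) = 1 / 2 := by simp [rRight]
  have hone : rRight K 1 = 1 := by rw [rRight]; ring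
  obtain ⟨g, h1, h2, h3, h4⟩ := exists_concave_inverse (show (1 / 2 : ℝ) < 1 by norm_num)
    (convexOn_rRight hK _ (convex_Icc _ _)) (by unfold rRight; fun_prop)
    ((rRight_strictMonoOn hK).mono hsub) hhalf hone
  have mh : (1 / 2 : ℝ) ∈ Icc (1 / 2 : ℝ) 1 := by norm_num
  have hg : g (1 / 2) = 1 / 2 := by
    refine (rRight_strictMonoOn hK).injOn (h1 _ mh).1.1 self_mem_Ici ?_
    rw [(h1 _ mh).2, hhalf]
  have zl : ∀ t ≤ (1 / 2 : ℝ), g (max t (1 / 2)) = 1 / 2 := fun t ht => by rw [max_eq_right ht, hg]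
  have zm : ∀ t ≤ (1 : ℝ), max t (1 / 2) ∈ Icc (1 / 2 : ℝ) 1 := fun t ht =>
    ⟨le_max_right _ _, max_le ht (by norm_num)⟩
  refine ⟨fun t => g (max t (1 / 2)), fun t ht => (h1 _ (zm t ht.2)).1, ?_, ?_, ?_, ?_,
    fun t ht => zl t ht.2, ?_⟩
  · intro t ht x hx
    rw [← h2 _ (zm t ht.2) x (Ioc_subset_Icc_self hx), le_max_iff, or_iff_left]
    rw [not_le, ← hhalf]
    exact rRight_strictMonoOn hK self_mem_Ici hx.1.le hx.1
  · intro u hu t ht hut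
    exact h3 (zm u hu.2) (zm t ht.2) (max_le_max hut le_rfl)
  · exact (concaveOn_const (1 / 2 : ℝ) (convex_Icc _ _)).congr fun t ht => (zl t ht.2).symm
  · refine h4.congr fun t ht => ?_
    rw [max_eq_left ht.1]
  · intro t ht
    have ht' : 1 / 2 + t ∈ Icc (1 / 2 : ℝ) 1 := ⟨by linarith [ht.1], by linarith [ht.2]⟩
    simp only
    rw [max_eq_left ht'.1, le_div_iff₀ hK.1]
    have h5 := (h1 _ ht').2
    rw [rRight] at h5
    nlinarith [mul_nonneg (by linarith [hK.2] : 0 ≤ 1 - K) (sq_nonneg (g (1 / 2 + t) - 1 / 2))]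

theorem measurable_lsvMap {α : ℝ} (hα : 0 < α) : Measurable (lsvMap α) :=
  Measurable.ite measurableSet_Iic (continuous_lsvLeft hα).measurable (by fun_prop)

theorem measurable_rMap {α : ℝ} (hα : 0 < α) (K : ℝ) : Measurable (rMap α K) :=
  Measurable.ite measurableSet_Iic (continuous_lsvLeft hα).measurable (by fun_prop)

/-- The family of LSV maps and maps `R_{α,K}` is an instance of `RandomSystem`. -/
theorem exists_randomSystem {N : ℕ} {α K : Fin N → ℝ} {SR : Finset (Fin N)}
    (hSS : SRᶜ.Nonempty) (hα : ∀ j, 0 < α j)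
    (hK : ∀ r ∈ SR, K r ∈ Ioo (0 : ℝ) 1) {T : Fin N → ℝ → ℝ}
    (hT : ∀ j, T j = if j ∈ SR then rMap (α j) (K j) else lsvMap (α j))
    {αmin : ℝ} (hαmin : IsLeast (range α) αmin) (hαmin1 : αmin < 1)
    {p : Fin N → ℝ} (hp : ∀ j, 0 < p j) (hp1 : ∑ j, p j = 1)
    (hη : ∑ r ∈ SR, p r * K r ^ (-αmin) < 1) :
    ∃ S : RandomSystem N, S.T = T ∧ S.p = p := by
  obtain ⟨s, hs⟩ := hSS
  obtain ⟨⟨jmin, hjmin⟩, -⟩ := hαmin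
  have hTS : ∀ j ∉ SR, T j = lsvMap (α j) := fun j hj => by rw [hT, if_neg hj]
  have hTR : ∀ j ∈ SR, T j = rMap (α j) (K j) := fun j hj => by rw [hT, if_pos hj]
  have hTl : ∀ j, ∀ x ≤ (1 / 2 : ℝ), T j x = lsvLeft (α j) x := by
    intro j x hx
    by_cases hj : j ∈ SR
    · rw [hTR j hj, rMap, if_pos hx]
    · rw [hTS j hj, lsvMap, if_pos hx]
  have hTRr : ∀ j ∈ SR, ∀ x, 1 / 2 < x → T j x = rRight (K j) x := by
    intro j hj x hx
    rw [hTR j hj, rMap, if_neg (not_le.2 hx), rRight]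
  have hTSr : ∀ j ∉ SR, ∀ x, 1 / 2 < x → T j x = 2 * x - 1 := by
    intro j hj x hx
    rw [hTS j hj, lsvMap, if_neg (not_le.2 hx)]
  obtain ⟨γ, ⟨hγ1, hγ2⟩, hγ⟩ : ∃ γ ∈ Ioo αmin 1, ∑ r ∈ SR, p r * K r ^ (-γ) < 1 := by
    have hc : ContinuousAt (fun γ : ℝ => ∑ r ∈ SR, p r * K r ^ (-γ)) αmin :=
      tendsto_finsetSum _ fun r hr => tendsto_const_nhds.mul
        ((Real.continuousAt_const_rpow (hK r hr).1.ne').comp continuousAt_neg)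
    have h1 := (hc.eventually_lt_const hη).filter_mono (nhdsWithin_le_nhds (s := Ioi αmin))
    have h2 : ∀ᶠ γ in 𝓝[>] αmin, γ ∈ Ioo αmin 1 := Ioo_mem_nhdsGT hαmin1
    exact (h2.and h1).exists
  choose y y_mem y_inv y_le y_mono y_conc y0 y1 y_half y_exp y_min using
    fun j => exists_inverse_lsvLeft (hα j)
  have hz : ∀ j, ∃ z : ℝ → ℝ,
      (∀ t ∈ Icc (0 : ℝ) 1, z t ∈ Icc (1 / 2 : ℝ) 1) ∧
      (∀ t ∈ Icc (0 : ℝ) 1, ∀ x ∈ Ioc (1 / 2 : ℝ) 1, T j x ≤ t ↔ x ≤ z t) ∧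
      MonotoneOn z (Icc 0 1) ∧ ConcaveOn ℝ (Icc 0 (1 / 2)) z ∧ ConcaveOn ℝ (Icc (1 / 2) 1) z ∧
      (j ∉ SR → ∀ t ∈ Icc (0 : ℝ) 1, z t = (1 + t) / 2) ∧
      (j ∈ SR → ∀ t ∈ Icc (0 : ℝ) (1 / 2), z t = 1 / 2) ∧
      (j ∈ SR → ∀ t ∈ Icc (0 : ℝ) (1 / 2), z (1 / 2 + t) - 1 / 2 ≤ t / K j) := by
    intro j
    by_cases hj : j ∈ SR
    · obtain ⟨z, h1, h2, h3, h4, h5, h6, h7⟩ := exists_inverse_rRight (hK j hj)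
      refine ⟨z, h1, fun t ht x hx => ?_, h3, h4, h5, fun h => absurd hj h, fun _ => h6,
        fun _ => h7⟩
      rw [hTRr j hj x hx.1]
      exact h2 t ht x hx
    · have hconc : ∀ s : Set ℝ, Convex ℝ s → ConcaveOn ℝ s fun t => (1 + t) / 2 := by
        refine fun s hs => ⟨hs, fun u _ t _ a b _ _ hab => ?_⟩
        simp only [smul_eq_mul]
        linarith
      refine ⟨fun t => (1 + t) / 2, fun t ht => ⟨by linarith [ht.1], by linarith [ht.2]⟩, ?_, ?_,
        hconc _ (convex_Icc _ _), hconc _ (convex_Icc _ _), fun _ _ _ => rfl,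
        fun h => absurd h hj, fun h => absurd h hj⟩
      · intro t _ x hx
        rw [hTSr j hj x hx.1]
        constructor <;> intro h <;> linarith
      · intro u _ t _ hut
        simp only
        linarith
  choose z z_mem z_le z_mono z_cl z_cr z_S z_R z_Rr using hz
  refine ⟨{ T := T, y := y, z := z, p := p, e := α, K := K, SR := SR, a := αmin, γ := γ,
            jmin := jmin, s := s
            meas := fun j => ?_
            p_pos := hp
            p_sum := hp1
            maps_to := fun j x hx => ?_
            preim := fun j t ht x hx => ?_
            y_mem := y_mem
            z_mem := z_mem
            y_mono := y_mono
            z_mono := z_mono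
            y_concave := y_conc
            z_concave_left := z_cl
            z_concave_right := z_cr
            y_zero := y0
            y_one := y1
            y_half := y_half
            y_expand := y_exp
            T_y := fun j t ht => ?_
            T_z := fun j hj t ht => ?_
            z_S := z_S
            z_R_left := z_R
            z_R_right := z_Rr
            e_pos := hα
            K_pos := fun j hj => (hK j hj).1
            s_notMem := Finset.mem_compl.1 hs
            a_pos := hjmin ▸ hα jmin
            a_lt := hγ1
            γ_lt := hγ2
            eta_lt := hγ
            y_min := hjmin ▸ y_min jmin }, rfl, rfl⟩
  · by_cases hj : j ∈ SR
    · rw [hTR j hj]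
      exact measurable_rMap (hα j) _
    · rw [hTS j hj]
      exact measurable_lsvMap (hα j)
  · rcases le_or_gt x (1 / 2) with h | h
    · rw [hTl j x h]
      constructor
      · rw [← lsvLeft_zero (α j)]
        exact lsvLeft_strictMonoOn (hα j) self_mem_Ici hx.1.le hx.1
      · rw [← lsvLeft_half (α j)]
        exact (lsvLeft_strictMonoOn (hα j)).monotoneOn hx.1.le (by norm_num) h
    · by_cases hj : j ∈ SR
      · rw [hTRr j hj x h]
        have hK' := hK j hj
        have e0 : rRight (K j) (1 / 2) = 1 / 2 := by simp [rRight]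
        have e1 : rRight (K j) 1 = 1 := by rw [rRight]; ring
        constructor
        · have := rRight_strictMonoOn hK' self_mem_Ici h.le h
          linarith
        · have := (rRight_strictMonoOn hK').monotoneOn h.le (by norm_num) hx.2
          linarith
      · rw [hTSr j hj x h]
        exact ⟨by linarith, by linarith [hx.2]⟩
  · rcases le_or_gt x (1 / 2) with h | h
    · rw [hTl j x h, y_le j t ht x ⟨hx.1.le, h⟩, or_iff_left]
      exact fun h' => absurd h (not_le.2 h'.1)
    · rw [z_le j t ht x ⟨h, hx.2⟩, or_iff_right]
      · exact ⟨fun h' => ⟨h, h'⟩, fun h' => h'.2⟩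
      · exact fun h' => absurd (h'.trans (y_mem j t ht).2) (not_le.2 h)
  · have ht' := Ioc_subset_Icc_self ht
    rw [hTl j _ (y_mem j t ht').2, y_inv j t ht']
  · rw [hTSr j hj _ (by linarith [ht.1])]
    ring

theorem RandomSystem.push_eq_iff {N : ℕ} (S : RandomSystem N) {μ : Measure ℝ}
    (hac : μ ≪ volume.restrict (Icc (0 : ℝ) 1)) :
    S.push μ = μ ↔ ∀ A : Set ℝ, MeasurableSet A → A ⊆ Icc (0 : ℝ) 1 →
      ∑ j, ENNReal.ofReal (S.p j) * μ (S.T j ⁻¹' A) = μ A := by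
  have hsupp : μ (Ioc 0 1)ᶜ = 0 := by
    refine hac ?_
    rw [Measure.restrict_apply measurableSet_Ioc.compl]
    refine measure_mono_null (t := {0}) ?_ Real.volume_singleton
    rintro x ⟨hx1, hx2⟩
    by_contra hx
    exact hx1 ⟨hx2.1.lt_of_ne fun h => hx h.symm, hx2.2⟩
  have hsupp' := S.push_supp hsupp
  refine ⟨fun h A hA _ => by rw [← S.push_apply μ hA, h], fun h => ?_⟩
  ext E hE
  have e : ∀ ν : Measure ℝ, ν (Ioc 0 1)ᶜ = 0 → ν E = ν (E ∩ Ioc 0 1) := fun ν hν =>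
    (measure_inter_conull hν).symm
  rw [e _ hsupp', e _ hsupp, S.push_apply _ (hE.inter measurableSet_Ioc)]
  exact h _ (hE.inter measurableSet_Ioc) (inter_subset_right.trans Ioc_subset_Icc_self)

end

/-- Theorem 1.2(1): if `η < 1` then `F` admits a unique absolutely continuous
stationary probability measure `μ_p`, and `F` is ergodic with respect to `ℙ × μ_p`. -/
theorem exists_unique_acs_of_eta_lt_one_and_ergodic
    (N : ℕ) (hN : 0 < N)
    (α K : Fin N → ℝ) (SR : Finset (Fin N))
    (hSR : SR.Nonempty) (hSS : SRᶜ.Nonempty)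
    (hα : ∀ j, 0 < α j)
    (hK : ∀ r ∈ SR, K r ∈ Set.Ioo (0 : ℝ) 1)
    (T : Fin N → ℝ → ℝ)
    (hT : ∀ j, T j = if j ∈ SR then rMap (α j) (K j) else lsvMap (α j))
    (αmin : ℝ) (hαmin : IsLeast (Set.range α) αmin) (hαmin1 : αmin < 1)
    (p : Fin N → ℝ) (hp : ∀ j, 0 < p j) (hp1 : ∑ j, p j = 1)
    (ℙ : Measure (ℕ → Fin N)) (hℙprob : IsProbabilityMeasure ℙ)
    (hℙ : ∀ (n : ℕ) (u : Fin n → Fin N),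
      ℙ {ω | ∀ i : Fin n, ω (i : ℕ) = u i} = ∏ i, ENNReal.ofReal (p (u i)))
    (hη : ∑ r ∈ SR, p r * K r ^ (-αmin) < 1) :
    ∃ μ : Measure ℝ,
      (IsProbabilityMeasure μ ∧
        μ ≪ volume.restrict (Set.Icc (0 : ℝ) 1) ∧
        ∀ A : Set ℝ, MeasurableSet A → A ⊆ Set.Icc (0 : ℝ) 1 →
          ∑ j, ENNReal.ofReal (p j) * μ (T j ⁻¹' A) = μ A) ∧
      (∀ μ' : Measure ℝ,
        (IsProbabilityMeasure μ' ∧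
          μ' ≪ volume.restrict (Set.Icc (0 : ℝ) 1) ∧
          ∀ A : Set ℝ, MeasurableSet A → A ⊆ Set.Icc (0 : ℝ) 1 →
            ∑ j, ENNReal.ofReal (p j) * μ' (T j ⁻¹' A) = μ' A) → μ' = μ) ∧
      Ergodic (skewProd T) (ℙ.prod μ) := by
  obtain ⟨S, rfl, rfl⟩ := exists_randomSystem hSS hα hK hT hαmin hαmin1 hp hp1 hη
  obtain ⟨μ, hμ, hac, hst⟩ := S.exists_good_stationary
  refine ⟨μ, ⟨hμ, hac, (S.push_eq_iff hac).1 hst⟩, ?_, RandomSystem.ergodic_skewProd hℙ hac hst⟩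
  rintro μ' ⟨hμ', hac', hst'⟩
  exact RandomSystem.stationary_unique hac' hac ((S.push_eq_iff hac').2 hst') hst
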